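/- arXiv:1907.01228 — 2 statements merged into one kernel-verified Lean document; each statement's English description precedes it below -/
import Mathlib

section
/- Let P ⊆ ℝ² be a simple polygon region with vertices v₁, …, vₙ, let p ∈ P, and let C be a connected component of P ∖ Vis(p), where Vis(p) = {q ∈ P : [p,q] ⊆ P}. Then there exist points x, y ∈ P such that (closure C) ∩ Vis(p) is exactly the segment [x,y]. -/
/-- `P` is a simple polygon region with the `n` vertices `v 0, …, v (n-1)`:
a compact subset of the plane with nonempty interior, equal to the closure of its
interior, whose frontier is the union of the `n` edges `[v i, v (i+1)]` (indices
mod `n`), such that consecutive edges meet exactly in their common vertex and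
non-consecutive edges are disjoint. -/
def IsSimplePolygonRegion {n : ℕ} [NeZero n]
    (P : Set (EuclideanSpace ℝ (Fin 2))) (v : Fin n → EuclideanSpace ℝ (Fin 2)) : Prop :=
  3 ≤ n ∧ Function.Injective v ∧ IsCompact P ∧ (interior P).Nonempty ∧
  P = closure (interior P) ∧
  frontier P = ⋃ i : Fin n, segment ℝ (v i) (v (i + 1)) ∧
  (∀ i : Fin n, segment ℝ (v i) (v (i + 1)) ∩ segment ℝ (v (i + 1)) (v (i + 1 + 1))
      = {v (i + 1)}) ∧
  (∀ i j : Fin n, i ≠ j → j ≠ i + 1 → i ≠ j + 1 →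
    Disjoint (segment ℝ (v i) (v (i + 1))) (segment ℝ (v j) (v (j + 1))))

namespace Pocket

section partA

open Set Filter Topology

section generic
variable {E : Type*} [NormedAddCommGroup E] [NormedSpace ℝ E]

/-- The polygon predicate in an arbitrary normed space. -/
def Poly {n : ℕ} [NeZero n] (P : Set E) (v : Fin n → E) : Prop :=
  3 ≤ n ∧ Function.Injective v ∧ IsCompact P ∧ (interior P).Nonempty ∧
  P = closure (interior P) ∧
  frontier P = ⋃ i : Fin n, segment ℝ (v i) (v (i + 1)) ∧
  (∀ i : Fin n, segment ℝ (v i) (v (i + 1)) ∩ segment ℝ (v (i + 1)) (v (i + 1 + 1))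
      = {v (i + 1)}) ∧
  (∀ i j : Fin n, i ≠ j → j ≠ i + 1 → i ≠ j + 1 →
    Disjoint (segment ℝ (v i) (v (i + 1))) (segment ℝ (v j) (v (j + 1))))

/-- visibility region -/
def Vis (P : Set E) (p : E) : Set E := {q | q ∈ P ∧ segment ℝ p q ⊆ P}

/-- rays -/
def Ray (q d : E) : Set E := {z | ∃ t : ℝ, 0 ≤ t ∧ z = q + t • d}

lemma preconn_frontier {X : Type*} [TopologicalSpace X] {P S : Set X} (hS : IsPreconnected S)
    (hd : ∀ z ∈ S, z ∉ frontier P)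
    {x y : X} (hx : x ∈ S) (hy : y ∈ S) (hxP : x ∈ P) : y ∈ P := by
  by_contra hyP
  have hsub : S ⊆ interior P ∪ (closure P)ᶜ := by
    intro z hz
    by_cases h : z ∈ interior P
    · exact Or.inl h
    · right
      intro hc
      exact hd z hz ⟨hc, h⟩
  have hxi : x ∈ interior P := by
    rcases hsub hx with h | h
    · exact h
    · exact absurd (subset_closure hxP) h
  have hyi : y ∈ (closure P)ᶜ := by
    rcases hsub hy with h | h
    · exact absurd (interior_subset h) hyP
    · exact h
  obtain ⟨z, -, hz1, hz2⟩ := hS _ _ isOpen_interior isClosed_closure.isOpen_compl hsub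
    ⟨x, hx, hxi⟩ ⟨y, hy, hyi⟩
  exact hz2 (subset_closure (interior_subset hz1))

lemma segment_split {x y q z : E} (hq : q ∈ segment ℝ x y) (hz : z ∈ segment ℝ x y) :
    z ∈ segment ℝ q x ∨ z ∈ segment ℝ q y := by
  rw [segment_eq_image_lineMap] at hq hz
  obtain ⟨s, hs, rfl⟩ := hq
  obtain ⟨r, hr, rfl⟩ := hz
  rcases le_total s r with h | h
  · right
    have := image_segment ℝ (AffineMap.lineMap x y : ℝ →ᵃ[ℝ] E) s 1
    rw [AffineMap.lineMap_apply_one] at this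
    rw [← this]
    exact mem_image_of_mem _ (by rw [segment_eq_Icc hs.2]; exact ⟨h, hr.2⟩)
  · left
    have := image_segment ℝ (AffineMap.lineMap x y : ℝ →ᵃ[ℝ] E) s 0
    rw [AffineMap.lineMap_apply_zero] at this
    rw [← this]
    exact mem_image_of_mem _ (by rw [segment_symm, segment_eq_Icc hs.1]; exact ⟨hr.1, h⟩)

lemma mem_seg_iff {q y z : E} : z ∈ segment ℝ q y ↔ ∃ t : ℝ, 0 ≤ t ∧ t ≤ 1 ∧ z = q + t • (y - q) := by
  rw [segment_eq_image']
  constructor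
  · rintro ⟨t, ht, rfl⟩
    exact ⟨t, ht.1, ht.2, rfl⟩
  · rintro ⟨t, h0, h1, rfl⟩
    exact ⟨t, ⟨h0, h1⟩, rfl⟩

lemma half_seg_local (q y : E) : ∃ ε > 0, ∀ z ∈ Metric.ball q ε,
    (z ∈ segment ℝ q y ↔ z ∈ Ray q (y - q)) := by
  by_cases h : y = q
  · subst h
    refine ⟨1, one_pos, fun z _ => ?_⟩
    simp [Ray]
    exact fun _ => ⟨0, le_rfl⟩
  · have hpos : 0 < ‖y - q‖ := norm_pos_iff.2 (sub_ne_zero.2 h)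
    refine ⟨‖y - q‖, hpos, fun z hz => ?_⟩
    rw [mem_seg_iff]
    constructor
    · rintro ⟨t, h0, h1, rfl⟩
      exact ⟨t, h0, rfl⟩
    · rintro ⟨t, h0, rfl⟩
      refine ⟨t, h0, ?_, rfl⟩
      rw [mem_ball_iff_norm, add_sub_cancel_left, norm_smul, Real.norm_of_nonneg h0] at hz
      nlinarith

lemma seg_local {x y q : E} (hq : q ∈ segment ℝ x y) : ∃ ε > 0, ∀ z ∈ Metric.ball q ε,
    (z ∈ segment ℝ x y ↔ z ∈ Ray q (x - q) ∨ z ∈ Ray q (y - q)) := by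
  obtain ⟨e1, h1, H1⟩ := half_seg_local q x
  obtain ⟨e2, h2, H2⟩ := half_seg_local q y
  refine ⟨min e1 e2, lt_min h1 h2, fun z hz => ?_⟩
  rw [← H1 z (Metric.ball_subset_ball (min_le_left _ _) hz),
    ← H2 z (Metric.ball_subset_ball (min_le_right _ _) hz)]
  constructor
  · exact segment_split hq
  · rintro (h | h)
    · exact (convex_segment x y).segment_subset hq (left_mem_segment _ _ _) h
    · exact (convex_segment x y).segment_subset hq (right_mem_segment _ _ _) h

lemma ray_cone {q d z : E} {t : ℝ} (ht : 0 < t) : q + t • (z - q) ∈ Ray q d ↔ z ∈ Ray q d := by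
  constructor
  · rintro ⟨s, hs, h⟩
    refine ⟨t⁻¹ * s, by positivity, ?_⟩
    rw [add_left_cancel_iff] at h
    rw [mul_smul, ← h, smul_smul, inv_mul_cancel₀ ht.ne', one_smul]
    abel
  · rintro ⟨s, hs, rfl⟩
    refine ⟨t * s, by positivity, ?_⟩
    rw [add_sub_cancel_left, smul_smul]

lemma seg_cone (x y q : E) : ∃ ε > 0, ∀ z ∈ Metric.ball q ε, ∀ t : ℝ, 0 < t → t ≤ 1 →
    (q + t • (z - q) ∈ segment ℝ x y ↔ z ∈ segment ℝ x y) := by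
  have hball : ∀ ε : ℝ, ∀ z ∈ Metric.ball q ε, ∀ t : ℝ, 0 < t → t ≤ 1 →
      q + t • (z - q) ∈ Metric.ball q ε := by
    intro ε z hz t h0 h1
    rw [mem_ball_iff_norm] at *
    rw [add_sub_cancel_left, norm_smul, Real.norm_of_nonneg h0.le]
    nlinarith [norm_nonneg (z - q)]
  by_cases hq : q ∈ segment ℝ x y
  · obtain ⟨ε, hε, H⟩ := seg_local hq
    refine ⟨ε, hε, fun z hz t h0 h1 => ?_⟩
    rw [H z hz, H _ (hball ε z hz t h0 h1), ray_cone h0, ray_cone h0]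
  · have hcl : IsClosed (segment ℝ x y) := by
      rw [segment_eq_image']
      exact (isCompact_Icc.image (by fun_prop)).isClosed
    obtain ⟨ε, hε, H⟩ := Metric.isOpen_iff.1 hcl.isOpen_compl q hq
    refine ⟨ε, hε, fun z hz t h0 h1 => ?_⟩
    have a := H hz
    have b := H (hball ε z hz t h0 h1)
    exact ⟨fun h => absurd h b, fun h => absurd h a⟩

lemma ball_cone {q z : E} {ε t : ℝ} (hz : z ∈ Metric.ball q ε) (h0 : 0 ≤ t) (h1 : t ≤ 1) :
      q + t • (z - q) ∈ Metric.ball q ε := by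
  rw [mem_ball_iff_norm] at *
  rw [add_sub_cancel_left, norm_smul, Real.norm_of_nonneg h0]
  nlinarith [norm_nonneg (z - q)]

lemma isClosed_seg (x y : E) : IsClosed (segment ℝ x y) := by
  rw [segment_eq_image']
  exact (isCompact_Icc.image (by fun_prop)).isClosed

lemma common_radius {ι : Type*} [Finite ι] (Q : ι → ℝ → Prop)
    (hmono : ∀ i e e', 0 < e' → e' ≤ e → Q i e → Q i e') (h : ∀ i, ∃ e > 0, Q i e) :
    ∃ e > 0, ∀ i, Q i e := by
  choose f hf hQ using h
  by_cases hne : Nonempty ι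
  · obtain ⟨i0, hi0⟩ := Finite.exists_min f
    exact ⟨f i0, hf i0, fun i => hmono i _ _ (hf i0) (hi0 i) (hQ i)⟩
  · exact ⟨1, one_pos, fun i => (hne ⟨i⟩).elim⟩

variable {n : ℕ} [NeZero n] {P : Set E} {v : Fin n → E}

lemma Poly.closed (h : Poly P v) : IsClosed P := h.2.2.1.isClosed

lemma Poly.frontier_cone (h : Poly P v) (q : E) : ∃ ε > 0, ∀ z ∈ Metric.ball q ε, ∀ t : ℝ,
    0 < t → t ≤ 1 → (q + t • (z - q) ∈ frontier P ↔ z ∈ frontier P) := by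
  obtain ⟨ε, hε, H⟩ := common_radius (fun (i : Fin n) e => ∀ z ∈ Metric.ball q e, ∀ t : ℝ,
    0 < t → t ≤ 1 → (q + t • (z - q) ∈ segment ℝ (v i) (v (i + 1)) ↔
      z ∈ segment ℝ (v i) (v (i + 1))))
    (fun i e e' _ hle hQ z hz => hQ z (Metric.ball_subset_ball hle hz))
    (fun i => seg_cone (v i) (v (i + 1)) q)
  refine ⟨ε, hε, fun z hz t h0 h1 => ?_⟩
  rw [h.2.2.2.2.2.1]
  simp only [mem_iUnion]
  exact exists_congr fun i => H i z hz t h0 h1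

lemma Poly.cone (h : Poly P v) (q : E) : ∃ ε > 0, ∀ z ∈ Metric.ball q ε, ∀ t : ℝ,
    0 < t → t ≤ 1 → (q + t • (z - q) ∈ P ↔ z ∈ P) := by
  obtain ⟨ε, hε, H⟩ := h.frontier_cone q
  refine ⟨ε, hε, fun z hz t h0 h1 => ?_⟩
  by_cases hzF : z ∈ frontier P
  · have h2 := (H z hz t h0 h1).2 hzF
    exact ⟨fun _ => h.closed.frontier_subset hzF, fun _ => h.closed.frontier_subset h2⟩
  · have hS : IsPreconnected ((fun s : ℝ => q + s • (z - q)) '' Ioc 0 1) :=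
      isPreconnected_Ioc.image _ (by fun_prop)
    have hd : ∀ w ∈ ((fun s : ℝ => q + s • (z - q)) '' Ioc 0 1), w ∉ frontier P := by
      rintro _ ⟨s, hs, rfl⟩ hw
      exact hzF ((H z hz s hs.1 hs.2).1 hw)
    have m1 : q + t • (z - q) ∈ ((fun s : ℝ => q + s • (z - q)) '' Ioc 0 1) := ⟨t, ⟨h0, h1⟩, rfl⟩
    have m2 : z ∈ ((fun s : ℝ => q + s • (z - q)) '' Ioc 0 1) := ⟨1, ⟨one_pos, le_rfl⟩, by simp⟩
    exact ⟨preconn_frontier hS hd m1 m2, preconn_frontier hS hd m2 m1⟩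

/-- one step in the frontier -/
def Step (F : Set E) (x y : E) : Prop := segment ℝ x y ⊆ F

lemma Poly.chain_v (h : Poly P v) (m : ℕ) :
    Relation.ReflTransGen (Step (frontier P)) (v 0) (v (Fin.ofNat n m)) := by
  induction m with
  | zero => exact Relation.ReflTransGen.refl
  | succ k ih =>
    refine ih.tail ?_
    have : (Fin.ofNat n (k + 1)) = Fin.ofNat n k + 1 := by
      ext
      simp [Fin.val_add, Fin.ofNat]
    rw [this, Step, h.2.2.2.2.2.1]
    exact subset_iUnion (fun i => segment ℝ (v i) (v (i + 1))) _

lemma Poly.chain0 (h : Poly P v) {a : E} (ha : a ∈ frontier P) :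
    Relation.ReflTransGen (Step (frontier P)) (v 0) a := by
  have hF := h.2.2.2.2.2.1
  have ha' := ha
  rw [hF] at ha'
  obtain ⟨i, hi⟩ := mem_iUnion.1 ha'
  have h1 := h.chain_v i.val
  have : Fin.ofNat n i.val = i := by ext; simp [Fin.ofNat, Nat.mod_eq_of_lt i.isLt]
  rw [this] at h1
  refine h1.tail ?_
  refine ((convex_segment _ _).segment_subset (left_mem_segment _ _ _) hi).trans ?_
  rw [hF]
  exact subset_iUnion (fun i => segment ℝ (v i) (v (i + 1))) i

lemma step_symm (F : Set E) : Std.Symm (Step F) := by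
  refine ⟨fun x y h => ?_⟩
  unfold Step at *
  rwa [segment_symm]

lemma Poly.chain (h : Poly P v) {a c : E} (ha : a ∈ frontier P) (hc : c ∈ frontier P) :
    Relation.ReflTransGen (Step (frontier P)) a c := by
  refine Relation.ReflTransGen.trans ?_ (h.chain0 hc)
  have : Std.Symm (Step (frontier P)) := step_symm _
  exact Relation.ReflTransGen.stdSymm.symm _ _ (h.chain0 ha)

lemma Poly.frontier_preconn (h : Poly P v) : IsPreconnected (frontier P) := by
  refine isPreconnected_of_forall_pair fun a ha c hc => ?_
  have := h.chain ha hc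
  induction this with
  | refl => exact ⟨{a}, by simpa using ha, rfl, rfl, isPreconnected_singleton⟩
  | @tail b c hab hbc ih =>
    have hb : b ∈ frontier P := hbc (left_mem_segment _ _ _)
    obtain ⟨t, ht, hat, hbt, htc⟩ := ih hb
    exact ⟨t ∪ segment ℝ b c, union_subset ht hbc, Or.inl hat, Or.inr (right_mem_segment _ _ _),
      htc.union b hbt (left_mem_segment _ _ _) (convex_segment b c).isPreconnected⟩

lemma Poly.vis_closed (h : Poly P v) (p : E) : IsClosed (Vis P p) := by
  have : Vis P p = P ∩ ⋂ t ∈ Icc (0:ℝ) 1, (fun q => p + t • (q - p)) ⁻¹' P := by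
    ext q
    simp only [Vis, mem_ofPred_eq, mem_inter_iff, mem_iInter, mem_preimage]
    refine and_congr_right fun _ => ?_
    rw [segment_eq_image', image_subset_iff]
    rfl
  rw [this]
  refine h.closed.inter (isClosed_biInter fun t _ => h.closed.preimage (by fun_prop))

lemma Poly.comp_open (h : Poly P v) {p x : E} {C : Set E}
    (hC : C = connectedComponentIn (P \ Vis P p) x) {z : E} (hz : z ∈ C) :
    ∃ ε > 0, ∀ w ∈ Metric.ball z ε, w ∈ P → w ∈ C := by
  have hzP : z ∈ P \ Vis P p := by rw [hC] at hz; exact connectedComponentIn_subset _ _ hz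
  obtain ⟨e1, he1, H1⟩ := h.cone z
  obtain ⟨e2, he2, H2⟩ := Metric.isOpen_iff.1 (h.vis_closed p).isOpen_compl z hzP.2
  refine ⟨min e1 e2, lt_min he1 he2, fun w hw hwP => ?_⟩
  have hseg : segment ℝ z w ⊆ P \ Vis P p := by
    intro u hu
    obtain ⟨t, h0, h1, rfl⟩ := mem_seg_iff.1 hu
    refine ⟨?_, H2 (ball_cone (Metric.ball_subset_ball (min_le_right _ _) hw) h0 h1)⟩
    rcases h0.eq_or_lt with h | h
    · rw [← h]; simpa using hzP.1
    · exact (H1 w (Metric.ball_subset_ball (min_le_left _ _) hw) t h h1).2 hwP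
  rw [hC] at hz
  rw [hC, connectedComponentIn_eq hz]
  exact (convex_segment z w).isPreconnected.subset_connectedComponentIn (left_mem_segment _ _ _)
    hseg (right_mem_segment _ _ _)

lemma Poly.comp_touch [Nontrivial E] (h : Poly P v) {p x : E} {C : Set E} (hp : p ∈ P)
    (hx : x ∈ P \ Vis P p)
    (hC : C = connectedComponentIn (P \ Vis P p) x) : (closure C ∩ Vis P p).Nonempty := by
  by_contra hne
  rw [not_nonempty_iff_eq_empty] at hne
  have hCP : C ⊆ P \ Vis P p := by rw [hC]; exact connectedComponentIn_subset _ _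
  have hxC : x ∈ C := by rw [hC]; exact mem_connectedComponentIn hx
  have hCpre : IsPreconnected C := by rw [hC]; exact isPreconnected_connectedComponentIn
  have hclP : closure C ⊆ P := closure_minimal (fun z hz => (hCP hz).1) h.closed
  have hCcl : closure C ⊆ C := by
    conv_rhs => rw [hC]
    refine hCpre.closure.subset_connectedComponentIn (subset_closure hxC) fun z hz => ⟨hclP hz, ?_⟩
    intro hzV
    have : z ∈ closure C ∩ Vis P p := ⟨hz, hzV⟩
    rw [hne] at this
    exact this
  have hCclosed : IsClosed C := closure_subset_iff_isClosed.1 hCcl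
  have hPne : P ≠ univ := by
    intro hu
    have := h.2.2.1
    rw [hu] at this
    exact noncompact_univ E this
  have hpV : p ∈ Vis P p := ⟨hp, by simpa using hp⟩
  have hpC : p ∉ C := fun hh => (hCP hh).2 hpV
  -- frontier of C meets F
  obtain ⟨z, hz⟩ : (frontier C).Nonempty :=
    nonempty_frontier_iff.2 ⟨⟨x, hxC⟩, fun hu => hPne (by
      rw [eq_univ_iff_forall] at *; exact fun y => (hCP (hu y)).1)⟩
  have hzC : z ∈ C := hCclosed.frontier_subset hz
  have hzF : z ∈ frontier P := by
    refine ⟨subset_closure (hCP hzC).1, fun hzi => hz.2 ?_⟩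
    obtain ⟨ε, hε, H⟩ := h.comp_open hC hzC
    rw [mem_interior_iff_mem_nhds] at *
    filter_upwards [hzi, Metric.ball_mem_nhds z hε] with w h1 h2 using H w h2 h1
  have hFC : frontier P ⊆ C := by
    by_contra hcon
    rw [not_subset] at hcon
    obtain ⟨y, hyF, hyC⟩ := hcon
    obtain ⟨w, hwF, hw1, hw2⟩ := h.frontier_preconn (interior (C ∪ Pᶜ)) Cᶜ isOpen_interior
      hCclosed.isOpen_compl (by
        intro w _
        by_cases hwC : w ∈ C
        · left
          obtain ⟨ε, hε, H⟩ := h.comp_open hC hwC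
          rw [mem_interior_iff_mem_nhds]
          filter_upwards [Metric.ball_mem_nhds w hε] with u hu
          by_cases huP : u ∈ P
          · exact Or.inl (H u hu huP)
          · exact Or.inr huP
        · exact Or.inr hwC) ⟨z, hzF, by
          obtain ⟨ε, hε, H⟩ := h.comp_open hC hzC
          rw [mem_interior_iff_mem_nhds]
          filter_upwards [Metric.ball_mem_nhds z hε] with u hu
          by_cases huP : u ∈ P
          · exact Or.inl (H u hu huP)
          · exact Or.inr huP⟩ ⟨y, hyF, hyC⟩
    rcases interior_subset hw1 with h1 | h1
    · exact hw2 h1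
    · exact h1 (h.closed.frontier_subset hwF)
  -- now the frontier of P \ C
  have hKclosed : IsClosed (P \ C) := by
    rw [← isOpen_compl_iff, isOpen_iff_mem_nhds]
    intro w hw
    by_cases hwC : w ∈ C
    · obtain ⟨ε, hε, H⟩ := h.comp_open hC hwC
      filter_upwards [Metric.ball_mem_nhds w hε] with u hu hu2
      exact hu2.2 (H u hu hu2.1)
    · have hwP : w ∉ P := fun hh => hw ⟨hh, hwC⟩
      filter_upwards [h.closed.isOpen_compl.mem_nhds hwP] with u hu hu2
      exact hu hu2.1
  obtain ⟨y, hy⟩ : (frontier (P \ C)).Nonempty :=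
    nonempty_frontier_iff.2 ⟨⟨p, hp, hpC⟩, fun hu => hPne (by
      rw [eq_univ_iff_forall] at *; exact fun y => (hu y).1)⟩
  have hyK := hKclosed.frontier_subset hy
  have hyi : y ∈ interior P := by
    by_contra hyi
    exact hyK.2 (hFC ⟨subset_closure hyK.1, hyi⟩)
  refine hy.2 ?_
  rw [mem_interior_iff_mem_nhds] at *
  filter_upwards [hyi, hCclosed.isOpen_compl.mem_nhds hyK.2] with w h1 h2 using ⟨h1, h2⟩

lemma Poly.near_p (h : Poly P v) {p x : E} {C : Set E} (hp : p ∈ P)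
    (hC : C = connectedComponentIn (P \ Vis P p) x) : p ∉ closure C := by
  obtain ⟨ε, hε, H⟩ := h.cone p
  intro hcl
  obtain ⟨w, hwC, hw⟩ := Metric.mem_closure_iff.1 hcl ε hε
  have hwP : w ∈ P \ Vis P p := by rw [hC] at hwC; exact connectedComponentIn_subset _ _ hwC
  refine hwP.2 ⟨hwP.1, fun u hu => ?_⟩
  obtain ⟨t, h0, h1, rfl⟩ := mem_seg_iff.1 hu
  rcases h0.eq_or_lt with h | h
  · rw [← h]; simpa using hp
  · exact (H w (by rwa [Metric.mem_ball, dist_comm]) t h h1).2 hwP.1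

end generic

end partA

end Pocket

namespace Pocket

section partB
open Set Filter Topology

/-- a sector -/
def Sector (q : ℂ) (ε α β : ℝ) : Set ℂ :=
  (fun x : ℝ × ℝ => q + (x.1 : ℂ) * Complex.exp (x.2 * Complex.I)) '' (Ioo 0 ε ×ˢ Ioo α β)

lemma sector_preconn (q : ℂ) (ε α β : ℝ) : IsPreconnected (Sector q ε α β) := by
  refine IsPreconnected.image ?_ _ (by fun_prop)
  exact isPreconnected_Ioo.prod isPreconnected_Ioo

lemma exists_polar (θ : ℝ) (z : ℂ) : ∃ ψ ∈ Ico θ (θ + 2 * Real.pi),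
    z = (‖z‖ : ℂ) * Complex.exp (ψ * Complex.I) := by
  refine ⟨toIcoMod Real.two_pi_pos θ z.arg, toIcoMod_mem_Ico _ _ _, ?_⟩
  conv_lhs => rw [← Complex.norm_mul_exp_arg_mul_I z]
  congr 1
  rw [Complex.exp_eq_exp_iff_exists_int]
  refine ⟨toIcoDiv Real.two_pi_pos θ z.arg, ?_⟩
  have := toIcoMod_add_toIcoDiv_zsmul Real.two_pi_pos θ z.arg
  conv_lhs => rw [← this]
  push_cast
  simp
  ring

lemma mem_ray_of_angle {d z : ℂ} {θ : ℝ} (hd : d ≠ 0) (hdp : d = (‖d‖ : ℂ) * Complex.exp (θ * Complex.I))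
    (hz : z = (‖z‖ : ℂ) * Complex.exp (θ * Complex.I)) (q : ℂ) : q + z ∈ Ray q d := by
  refine ⟨‖z‖ / ‖d‖, by positivity, ?_⟩
  have : (‖d‖ : ℂ) ≠ 0 := by simpa using hd
  rw [add_right_inj, Complex.real_smul]
  push_cast
  rw [div_mul_eq_mul_div, eq_div_iff this]
  linear_combination (‖d‖ : ℂ) * hz - (‖z‖ : ℂ) * hdp

/-- The complement of two rays is covered by two connected sectors. -/
lemma two_sectors {q d1 d2 : ℂ} (h1 : d1 ≠ 0) (h2 : d2 ≠ 0) (ε : ℝ) :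
    ∃ S1 S2 : Set ℂ, IsPreconnected S1 ∧ IsPreconnected S2 ∧ S1 ⊆ Metric.ball q ε ∧
      S2 ⊆ Metric.ball q ε ∧
      (∀ z ∈ Metric.ball q ε, z ∈ Ray q d1 ∨ z ∈ Ray q d2 ∨ z ∈ S1 ∨ z ∈ S2) ∧
      (¬ (d2 ∈ Ray 0 d1) → ∀ z ∈ S1 ∪ S2, z ∉ Ray q d1 ∧ z ∉ Ray q d2) := by
  obtain ⟨θ1, -, hθ1⟩ := exists_polar 0 d1
  obtain ⟨θ2, hm2, hθ2⟩ := exists_polar θ1 d2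
  have hsb : ∀ α β, Sector q ε α β ⊆ Metric.ball q ε := by
    rintro α β _ ⟨⟨r, ψ⟩, ⟨hr, hψ⟩, rfl⟩
    simp only [mem_Ioo] at hr
    rw [mem_ball_iff_norm, add_sub_cancel_left, norm_mul, Complex.norm_exp_ofReal_mul_I]
    simp [abs_of_pos hr.1, hr.2]
  refine ⟨Sector q ε θ1 θ2, Sector q ε θ2 (θ1 + 2 * Real.pi), sector_preconn _ _ _ _,
    sector_preconn _ _ _ _, hsb _ _, hsb _ _, ?_, ?_⟩
  · intro z hz
    obtain ⟨w, rfl⟩ : ∃ w, z = q + w := ⟨z - q, by ring⟩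
    rw [mem_ball_iff_norm, add_sub_cancel_left] at hz
    obtain ⟨ψ, hψ, hw⟩ := exists_polar θ1 w
    by_cases e1 : ψ = θ1
    · left; subst e1; exact mem_ray_of_angle h1 hθ1 hw q
    by_cases e2 : ψ = θ2
    · right; left; subst e2; exact mem_ray_of_angle h2 hθ2 hw q
    by_cases hw0 : w = 0
    · left; exact ⟨0, le_rfl, by simp [hw0]⟩
    have hwpos : 0 < ‖w‖ := norm_pos_iff.2 hw0
    right; right
    rcases lt_or_gt_of_ne e2 with e | e
    · left
      exact ⟨(‖w‖, ψ), ⟨⟨hwpos, hz⟩, ⟨lt_of_le_of_ne hψ.1 (Ne.symm e1), e⟩⟩, by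
        simp only; rw [← hw]⟩
    · right
      exact ⟨(‖w‖, ψ), ⟨⟨hwpos, hz⟩, ⟨e, hψ.2⟩⟩, by simp only; rw [← hw]⟩
  · intro hns
    have key : ∀ r ψ : ℝ, 0 < r → ∀ (d : ℂ) (θ : ℝ), d ≠ 0 →
        d = (‖d‖ : ℂ) * Complex.exp (θ * Complex.I) →
        q + (r : ℂ) * Complex.exp (ψ * Complex.I) ∈ Ray q d → ∃ m : ℤ, ψ = θ + m * (2 * Real.pi) := by
      rintro r ψ hr d θ hd hdp ⟨t, ht, hz⟩
      rw [add_right_inj, Complex.real_smul] at hz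
      have hn := congrArg norm hz
      rw [norm_mul, norm_mul, Complex.norm_exp_ofReal_mul_I] at hn
      simp only [Complex.norm_real, Real.norm_of_nonneg hr.le, Real.norm_of_nonneg ht, mul_one] at hn
      rw [hdp, ← mul_assoc, hn] at hz
      push_cast at hz
      have hne : (t : ℂ) * (‖d‖ : ℂ) ≠ 0 := by
        rw [← Complex.ofReal_mul, ← hn]; exact_mod_cast hr.ne'
      have := mul_left_cancel₀ hne hz
      rw [Complex.exp_eq_exp_iff_exists_int] at this
      obtain ⟨m, hm⟩ := this
      refine ⟨m, ?_⟩
      have := congrArg Complex.im hm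
      simpa using this
    have hpi := Real.pi_pos
    have hθne : θ2 ≠ θ1 := by
      intro h
      apply hns
      subst h
      have := mem_ray_of_angle h1 hθ1 hθ2 0
      simpa using this
    have hθlt : θ1 < θ2 := lt_of_le_of_ne hm2.1 (Ne.symm hθne)
    have nomult : ∀ x : ℝ, ∀ m : ℤ, x = m * (2 * Real.pi) → -(2 * Real.pi) < x → x < 2 * Real.pi →
        x = 0 := by
      intro x m hx hl hu
      have a1 : (m : ℝ) < 1 := by by_contra hc; push Not at hc; nlinarith
      have a2 : (-1 : ℝ) < m := by by_contra hc; push Not at hc; nlinarith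
      have : m = 0 := by
        have b1 : m < 1 := by exact_mod_cast a1
        have b2 : -1 < m := by exact_mod_cast a2
        omega
      rw [hx, this]; simp
    have hm22 := hm2.2
    rintro z (⟨⟨r, ψ⟩, ⟨hr, hψ⟩, rfl⟩ | ⟨⟨r, ψ⟩, ⟨hr, hψ⟩, rfl⟩)
    · simp only [mem_Ioo] at hr hψ
      constructor
      · intro hz
        obtain ⟨m, hm⟩ := key r ψ hr.1 d1 θ1 h1 hθ1 hz
        have := nomult (ψ - θ1) m (by linarith) (by linarith) (by linarith)
        linarith
      · intro hz
        obtain ⟨m, hm⟩ := key r ψ hr.1 d2 θ2 h2 hθ2 hz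
        have := nomult (ψ - θ2) m (by linarith) (by linarith) (by linarith)
        linarith
    · simp only [mem_Ioo] at hr hψ
      constructor
      · intro hz
        obtain ⟨m, hm⟩ := key r ψ hr.1 d1 θ1 h1 hθ1 hz
        have := nomult (ψ - θ1) m (by linarith) (by linarith) (by linarith)
        linarith
      · intro hz
        obtain ⟨m, hm⟩ := key r ψ hr.1 d2 θ2 h2 hθ2 hz
        have := nomult (ψ - θ2) m (by linarith) (by linarith) (by linarith)
        linarith

variable {n : ℕ} [NeZero n] {P : Set ℂ} {v : Fin n → ℂ}

/-- At a frontier point the frontier is locally two different rays. -/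
lemma Poly.local_rays (h : Poly P v) {q : ℂ} (hq : q ∈ frontier P) :
    ∃ d1 d2 : ℂ, d1 ≠ 0 ∧ d2 ≠ 0 ∧ d2 ∉ Ray 0 d1 ∧ ∃ ε > 0, ∀ z ∈ Metric.ball q ε,
      (z ∈ frontier P ↔ z ∈ Ray q d1 ∨ z ∈ Ray q d2) := by
  obtain ⟨hn, hinj, hcomp, hne, hcl, hF, hcons, hdisj⟩ := h
  have hsucc : ∀ i : Fin n, i + 1 ≠ i := by
    intro i hi
    have h1 : (1 : Fin n) = 0 := by simpa using hi
    have := congrArg Fin.val h1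
    rw [Fin.val_one', Nat.mod_eq_of_lt (by omega)] at this
    simp at this
  -- rays from local structure of each edge
  have away : ∀ i : Fin n, q ∉ segment ℝ (v i) (v (i + 1)) →
      ∃ e > 0, ∀ z ∈ Metric.ball q e, z ∉ segment ℝ (v i) (v (i + 1)) := by
    intro i hi
    obtain ⟨ε, hε, H⟩ := Metric.isOpen_iff.1 (isClosed_seg (v i) (v (i+1))).isOpen_compl q hi
    exact ⟨ε, hε, fun z hz => H hz⟩
  have other : ∀ T : Set (Fin n), (∀ i, i ∉ T → q ∉ segment ℝ (v i) (v (i + 1))) →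
      ∃ e > 0, ∀ i, i ∉ T → ∀ z ∈ Metric.ball q e, z ∉ segment ℝ (v i) (v (i + 1)) := by
    intro T hT
    refine common_radius (fun (i : Fin n) e => i ∉ T → ∀ z ∈ Metric.ball q e,
      z ∉ segment ℝ (v i) (v (i + 1))) ?_ ?_
    · intro i e e' _ hle hQ hi z hz
      exact hQ hi z (Metric.ball_subset_ball hle hz)
    · intro i
      by_cases hi : i ∈ T
      · exact ⟨1, one_pos, fun hh => absurd hi hh⟩
      · obtain ⟨e, he, H⟩ := away i (hT i hi)
        exact ⟨e, he, fun _ => H⟩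
  have hmemF : ∀ z, z ∈ frontier P ↔ ∃ i, z ∈ segment ℝ (v i) (v (i + 1)) := by
    intro z; rw [hF, mem_iUnion]
  by_cases hv : ∃ i, q = v (i + 1)
  · obtain ⟨i, rfl⟩ := hv
    obtain ⟨e0, he0, H0⟩ := other {i, i + 1} (by
      intro j hj hmem
      simp only [mem_insert_iff, mem_singleton_iff, not_or] at hj
      by_cases hji : i = j + 1
      · have := hcons j
        rw [← hji] at this
        have h2 : v (i + 1) ∈ ({v i} : Set ℂ) := by
          rw [← this]; refine ⟨?_, right_mem_segment _ _ _⟩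
          rwa [← hji] at hmem
        exact hsucc i (hinj h2)
      · exact disjoint_left.1 (hdisj i j (Ne.symm hj.1) hj.2 hji) (right_mem_segment _ _ _) hmem)
    obtain ⟨e1, he1, H1⟩ := half_seg_local (v (i + 1)) (v i)
    obtain ⟨e2, he2, H2⟩ := half_seg_local (v (i + 1)) (v (i + 1 + 1))
    refine ⟨v i - v (i + 1), v (i + 1 + 1) - v (i + 1), ?_, ?_, ?_, min e0 (min e1 e2),
      lt_min he0 (lt_min he1 he2), ?_⟩
    · exact sub_ne_zero.2 fun hh => hsucc i (hinj hh).symm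
    · exact sub_ne_zero.2 fun hh => hsucc (i + 1) (hinj hh)
    · rintro ⟨t, ht, hh⟩
      -- common point
      have hd2 : v (i + 1 + 1) - v (i + 1) ≠ 0 := sub_ne_zero.2 fun hh => hsucc (i + 1) (hinj hh)
      rw [zero_add] at hh
      have htpos : 0 < t := by
        rcases ht.eq_or_lt with h | h
        · rw [← h, zero_smul] at hh; exact absurd hh hd2
        · exact h
      set s : ℝ := 1 / (1 + t) with hs
      have hs0 : 0 < s := by positivity
      have hs1 : s ≤ 1 := by rw [hs, div_le_one (by positivity)]; linarith
      have hst : s * t ≤ 1 := by rw [hs, one_div_mul_eq_div, div_le_one (by positivity)]; linarith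
      have m2 : v (i + 1) + s • (v (i + 1 + 1) - v (i + 1)) ∈ segment ℝ (v (i + 1)) (v (i + 1 + 1)) :=
        mem_seg_iff.2 ⟨s, hs0.le, hs1, rfl⟩
      have m1 : v (i + 1) + s • (v (i + 1 + 1) - v (i + 1)) ∈ segment ℝ (v i) (v (i + 1)) := by
        rw [segment_symm]
        exact mem_seg_iff.2 ⟨s * t, by positivity, hst, by rw [hh, smul_smul]⟩
      have : v (i + 1) + s • (v (i + 1 + 1) - v (i + 1)) ∈ ({v (i + 1)} : Set ℂ) := by
        rw [← hcons i]; exact ⟨m1, m2⟩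
      rw [mem_singleton_iff, add_eq_left, smul_eq_zero] at this
      rcases this with h | h
      · exact hs0.ne' h
      · exact hd2 h
    · intro z hz
      rw [← H1 z (Metric.ball_subset_ball ((min_le_right _ _).trans (min_le_left _ _)) hz),
        ← H2 z (Metric.ball_subset_ball ((min_le_right _ _).trans (min_le_right _ _)) hz), hmemF]
      constructor
      · rintro ⟨j, hj⟩
        by_cases hjT : j ∈ ({i, i + 1} : Set (Fin n))
        · rcases hjT with rfl | hj2
          · left; rwa [segment_symm]
          · rw [mem_singleton_iff] at hj2; subst hj2; exact Or.inr hj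
        · exact absurd hj (H0 j hjT z (Metric.ball_subset_ball (min_le_left _ _) hz))
      · rintro (hz | hz)
        · exact ⟨i, by rwa [segment_symm]⟩
        · exact ⟨i + 1, hz⟩
  · push Not at hv
    obtain ⟨i, hi⟩ := (hmemF q).1 hq
    have hqi : q ≠ v i := by
      have := hv (i - 1)
      rwa [sub_add_cancel] at this
    have hqi1 : q ≠ v (i + 1) := hv i
    obtain ⟨e0, he0, H0⟩ := other {i} (by
      intro j hj hmem
      simp only [mem_singleton_iff] at hj
      by_cases h1 : j = i + 1
      · subst h1
        have : q ∈ ({v (i + 1)} : Set ℂ) := by rw [← hcons i]; exact ⟨hi, hmem⟩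
        exact hqi1 this
      · by_cases h2 : i = j + 1
        · subst h2
          have : q ∈ ({v (j + 1)} : Set ℂ) := by rw [← hcons j]; exact ⟨hmem, hi⟩
          exact hqi this
        · exact disjoint_left.1 (hdisj i j (Ne.symm hj) h1 h2) hi hmem)
    obtain ⟨e1, he1, H1⟩ := seg_local hi
    have hd1 : v i - q ≠ 0 := sub_ne_zero.2 hqi.symm
    have hd2 : v (i + 1) - q ≠ 0 := sub_ne_zero.2 hqi1.symm
    refine ⟨v i - q, v (i + 1) - q, hd1, hd2, ?_, min e0 e1, lt_min he0 he1, ?_⟩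
    · rintro ⟨t, ht, hh⟩
      rw [segment_symm] at hi
      obtain ⟨s, hs0, hs1, hs⟩ := mem_seg_iff.1 hi
      -- q = v(i+1) + s (v i - v (i+1))
      have key : (1 - s) • (v (i + 1) - q) + s • (v i - q) = 0 := by
        have : q - v (i + 1) = s • (v i - v (i + 1)) := by
          conv_lhs => rw [hs]
          abel
        have e : v (i + 1) - q = - (s • (v i - v (i + 1))) := by rw [← this]; abel
        simp only [Complex.real_smul] at *
        push_cast
        linear_combination e
      rw [hh, zero_add, smul_smul, ← add_smul, smul_eq_zero] at key
      rcases key with k | k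
      · have h1 : 0 ≤ (1 - s) * t := mul_nonneg (by linarith) ht
        have hs00 : s = 0 := by linarith
        rw [hs00] at hs
        simp at hs
        exact hqi1 hs
      · exact hd1 k
    · intro z hz
      rw [← H1 z (Metric.ball_subset_ball (min_le_right _ _) hz), hmemF]
      constructor
      · rintro ⟨j, hj⟩
        by_cases hjT : j ∈ ({i} : Set (Fin n))
        · rw [mem_singleton_iff] at hjT; subst hjT; exact hj
        · exact absurd hj (H0 j hjT z (Metric.ball_subset_ball (min_le_left _ _) hz))
      · exact fun hz => ⟨i, hz⟩

/-- small balls meet interior and exterior in connected sets -/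
lemma Poly.local_conn (h : Poly P v) {q : ℂ} (hq : q ∈ P) : ∃ ε0 > 0, ∀ ε, 0 < ε → ε ≤ ε0 →
    IsPreconnected (Metric.ball q ε ∩ interior P) ∧ IsPreconnected (Metric.ball q ε ∩ Pᶜ) := by
  by_cases hqi : q ∈ interior P
  · obtain ⟨ε0, hε0, H⟩ := Metric.isOpen_iff.1 isOpen_interior q hqi
    refine ⟨ε0, hε0, fun ε h0 hle => ?_⟩
    have hb : Metric.ball q ε ⊆ interior P := (Metric.ball_subset_ball hle).trans H
    constructor
    · rw [inter_eq_left.2 hb]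
      exact (convex_ball q ε).isPreconnected
    · rw [(disjoint_compl_right_iff_subset.2 (hb.trans interior_subset)).inter_eq]
      exact isPreconnected_empty
  have hqF : q ∈ frontier P := ⟨subset_closure hq, hqi⟩
  obtain ⟨d1, d2, hd1, hd2, hns, ε0, hε0, H⟩ := h.local_rays hqF
  refine ⟨ε0, hε0, fun ε h0 hle => ?_⟩
  obtain ⟨S1, S2, hS1, hS2, hb1, hb2, hcov, hoff⟩ := two_sectors (q := q) hd1 hd2 ε
  have hoff := hoff hns
  have hoffF : ∀ z ∈ S1 ∪ S2, z ∉ frontier P := by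
    intro z hz hzF
    have hzb : z ∈ Metric.ball q ε := hz.elim (fun h => hb1 h) (fun h => hb2 h)
    rcases (H z (Metric.ball_subset_ball hle hzb)).1 hzF with h | h
    · exact (hoff z hz).1 h
    · exact (hoff z hz).2 h
  have hcovF : ∀ z ∈ Metric.ball q ε, z ∉ frontier P → z ∈ S1 ∨ z ∈ S2 := by
    intro z hz hzF
    rw [H z (Metric.ball_subset_ball hle hz)] at hzF
    have := hcov z hz
    tauto
  have int_of : ∀ z, z ∈ P → z ∉ frontier P → z ∈ interior P := by
    intro z hz hzF
    by_contra hi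
    exact hzF ⟨subset_closure hz, hi⟩
  have int_not : ∀ z, z ∈ interior P → z ∉ frontier P := fun z hz hzF => hzF.2 hz
  have ext_not : ∀ z, z ∉ P → z ∉ frontier P := fun z hz hzF => hz (h.closed.frontier_subset hzF)
  -- points of both kinds
  obtain ⟨x, hxb, hxi⟩ : ∃ x ∈ Metric.ball q ε, x ∈ interior P := by
    have : q ∈ closure (interior P) := by rw [← h.2.2.2.2.1]; exact hq
    obtain ⟨x, hx, hd⟩ := Metric.mem_closure_iff.1 this ε h0
    exact ⟨x, by rwa [Metric.mem_ball, dist_comm], hx⟩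
  obtain ⟨y, hyb, hyP⟩ : ∃ y ∈ Metric.ball q ε, y ∉ P := by
    have : q ∈ closure Pᶜ := by rw [closure_compl]; exact hqi
    obtain ⟨x, hx, hd⟩ := Metric.mem_closure_iff.1 this ε h0
    exact ⟨x, by rwa [Metric.mem_ball, dist_comm], hx⟩
  have main : ∀ A B : Set ℂ, IsPreconnected A → IsPreconnected B → A ⊆ Metric.ball q ε →
      B ⊆ Metric.ball q ε → (∀ z ∈ A ∪ B, z ∉ frontier P) →
      (∀ z ∈ Metric.ball q ε, z ∉ frontier P → z ∈ A ∨ z ∈ B) → x ∈ A →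
      IsPreconnected (Metric.ball q ε ∩ interior P) ∧ IsPreconnected (Metric.ball q ε ∩ Pᶜ) := by
    intro A B hA hB hAb hBb hABF hABc hxA
    have hAF : ∀ z ∈ A, z ∉ frontier P := fun z hz => hABF z (Or.inl hz)
    have hBF : ∀ z ∈ B, z ∉ frontier P := fun z hz => hABF z (Or.inr hz)
    have hAP : A ⊆ P := fun z hz => preconn_frontier hA hAF hxA hz (interior_subset hxi)
    have hyB : y ∈ B := by
      rcases hABc y hyb (ext_not y hyP) with h | h
      · exact absurd (hAP h) hyP
      · exact h
    have hBP : B ⊆ Pᶜ := fun z hz hzP => hyP (preconn_frontier hB hBF hz hyB hzP)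
    have eA : Metric.ball q ε ∩ interior P = A := by
      ext z
      constructor
      · rintro ⟨hz, hzi⟩
        rcases hABc z hz (int_not z hzi) with h | h
        · exact h
        · exact absurd (interior_subset hzi) (hBP h)
      · exact fun hz => ⟨hAb hz, int_of z (hAP hz) (hAF z hz)⟩
    have eB : Metric.ball q ε ∩ Pᶜ = B := by
      ext z
      constructor
      · rintro ⟨hz, hzi⟩
        rcases hABc z hz (ext_not z hzi) with h | h
        · exact absurd (hAP h) hzi
        · exact h
      · exact fun hz => ⟨hBb hz, hBP hz⟩
    rw [eA, eB]
    exact ⟨hA, hB⟩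
  rcases hcovF x hxb (int_not x hxi) with hx1 | hx2
  · exact main S1 S2 hS1 hS2 hb1 hb2 hoffF hcovF hx1
  · exact main S2 S1 hS2 hS1 hb2 hb1 (fun z hz => hoffF z hz.symm)
      (fun z hz hzF => (hcovF z hz hzF).symm) hx2

end partB

end Pocket

namespace Pocket

section partC
open Set Filter Topology

lemma slit_of_not_mem {a c z : ℂ} (hz : z ∉ segment ℝ a c) : (z - a) / (z - c) ∈ Complex.slitPlane := by
  by_contra hs
  rw [Complex.mem_slitPlane_iff] at hs
  push Not at hs
  obtain ⟨hre, him⟩ := hs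
  have hzc : z - c ≠ 0 := by
    intro h
    rw [sub_eq_zero] at h
    exact hz (h ▸ right_mem_segment _ _ _)
  set w := (z - a) / (z - c) with hw
  have hwr : w = ((w.re : ℝ) : ℂ) := by
    apply Complex.ext <;> simp [him]
  have h1 : z - a = w.re * (z - c) := by
    rw [← hwr, hw, div_mul_cancel₀ _ hzc]
  set r := w.re
  apply hz
  have hpos : 0 < 1 - r := by linarith
  refine mem_seg_iff.2 ⟨(-r) / (1 - r), div_nonneg (by linarith) hpos.le,
    by rw [div_le_one hpos]; linarith, ?_⟩
  have hne : (1 - (r : ℂ)) ≠ 0 := by exact_mod_cast hpos.ne'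
  rw [Complex.real_smul]
  push_cast
  field_simp
  linear_combination h1

lemma chain_log {F : Set ℂ} {a c : ℂ} (ha : a ∈ F) (h : Relation.ReflTransGen (Step F) a c) :
    ∃ L : ℂ → ℂ, ContinuousOn L Fᶜ ∧ ∀ z, z ∉ F → Complex.exp (L z) = (z - a) / (z - c) := by
  induction h with
  | refl =>
    refine ⟨fun _ => 0, continuousOn_const, fun z hz => ?_⟩
    have : z - a ≠ 0 := sub_ne_zero.2 fun h => hz (h ▸ ha)
    simp [div_self this]
  | @tail b c hab hbc ih =>
    obtain ⟨L, hL, hexp⟩ := ih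
    refine ⟨fun z => L z + Complex.log ((z - b) / (z - c)), ?_, ?_⟩
    · refine hL.add ?_
      refine ContinuousOn.clog ?_ fun z hz => slit_of_not_mem fun h => hz (hbc h)
      refine ContinuousOn.div (by fun_prop) (by fun_prop) fun z hz h => hz ?_
      rw [sub_eq_zero.1 h]; exact hbc (right_mem_segment _ _ _)
    · intro z hz
      have hb : z - b ≠ 0 := sub_ne_zero.2 fun h => hz (h ▸ hbc (left_mem_segment _ _ _))
      have hc : z - c ≠ 0 := sub_ne_zero.2 fun h => hz (h ▸ hbc (right_mem_segment _ _ _))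
      rw [Complex.exp_add, hexp z hz, Complex.exp_log (div_ne_zero hb hc)]
      field_simp

lemma const_of_int {S : Set ℂ} (hS : IsPreconnected S) {g : ℂ → ℝ} (hg : ContinuousOn g S)
    (hi : ∀ z ∈ S, ∃ m : ℤ, g z = m * (2 * Real.pi)) : ∀ x ∈ S, ∀ y ∈ S, g x = g y := by
  have main : ∀ x ∈ S, ∀ y ∈ S, ¬ g x < g y := by
    intro x hx y hy hlt
    obtain ⟨m, hm⟩ := hi x hx
    obtain ⟨k, hk⟩ := hi y hy
    have hpi := Real.pi_pos
    have hmk : m + 1 ≤ k := by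
      by_contra hc
      have : k ≤ m := by omega
      have : (k : ℝ) ≤ m := by exact_mod_cast this
      nlinarith
    have hmk' : (m : ℝ) + 1 ≤ k := by exact_mod_cast hmk
    obtain ⟨z, hz, hgz⟩ := hS.intermediate_value hx hy hg
      (show (m + 1 / 2 : ℝ) * (2 * Real.pi) ∈ Icc (g x) (g y) by
        constructor <;> nlinarith)
    obtain ⟨l, hl⟩ := hi z hz
    rw [hl] at hgz
    have : (l : ℝ) = m + 1 / 2 := mul_right_cancel₀ (by positivity) hgz
    have h2 : (2 * l : ℝ) = 2 * m + 1 := by linarith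
    have h3 : 2 * l = 2 * m + 1 := by exact_mod_cast h2
    omega
  intro x hx y hy
  exact le_antisymm (not_lt.1 (main y hy x hx)) (not_lt.1 (main x hx y hy))

lemma sep {F : Set ℂ} (hF : IsClosed F) {a b : ℝ} (ha : (a : ℂ) ∈ F) (hb : (b : ℂ) ∈ F)
    (hch : Relation.ReflTransGen (Step F) (a : ℂ) (b : ℂ)) :
    ∃ g : ℂ → ℝ, (∀ S, IsPreconnected S → (∀ z ∈ S, z ∉ F ∧ z ∉ segment ℝ (a : ℂ) b) →
        ∀ x ∈ S, ∀ y ∈ S, g x = g y) ∧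
      ∀ σ : ℝ, a < σ → σ < b → (σ : ℂ) ∉ F → ∀ k : ℝ,
        (∀ᶠ y : ℝ in 𝓝[>] 0, g (σ + y * Complex.I) = k) →
        (∀ᶠ y : ℝ in 𝓝[>] 0, g (σ - y * Complex.I) = k) → False := by
  obtain ⟨L, hL, hexp⟩ := chain_log ha hch
  refine ⟨fun z => (L z - Complex.log ((z - a) / (z - b))).im, ?_, ?_⟩
  · intro S hS hoff
    refine const_of_int hS ?_ ?_
    · refine Complex.continuous_im.comp_continuousOn ?_
      refine (hL.mono fun z hz => (hoff z hz).1).sub ?_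
      refine ContinuousOn.clog ?_ fun z hz => slit_of_not_mem (hoff z hz).2
      refine ContinuousOn.div (by fun_prop) (by fun_prop) fun z hz h => (hoff z hz).1 ?_
      rw [sub_eq_zero.1 h]; exact hb
    · intro z hz
      have hzF := (hoff z hz).1
      have h1 : z - a ≠ 0 := sub_ne_zero.2 fun h => hzF (h ▸ ha)
      have h2 : z - b ≠ 0 := sub_ne_zero.2 fun h => hzF (h ▸ hb)
      have : Complex.exp (L z - Complex.log ((z - a) / (z - b))) = 1 := by
        rw [Complex.exp_sub, hexp z hzF, Complex.exp_log (div_ne_zero h1 h2),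
          div_self (div_ne_zero h1 h2)]
      obtain ⟨m, hm⟩ := Complex.exp_eq_one_iff.1 this
      refine ⟨m, ?_⟩
      rw [hm]
      simp
  · intro σ haσ hσb hσF k hup hlo
    have hcL : ContinuousAt L (σ : ℂ) := hL.continuousAt (hF.isOpen_compl.mem_nhds hσF)
    have hbne : ((σ : ℂ) - b) ≠ 0 := by
      rw [← Complex.ofReal_sub]; exact_mod_cast (by linarith : σ - b ≠ 0)
    have hw0 : ((σ : ℂ) - a) / (σ - b) = (((σ - a) / (σ - b) : ℝ) : ℂ) := by push_cast; rfl
    have hre : (((σ : ℂ) - a) / (σ - b)).re < 0 := by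
      rw [hw0, Complex.ofReal_re]
      exact div_neg_of_pos_of_neg (by linarith) (by linarith)
    have him : (((σ : ℂ) - a) / (σ - b)).im = 0 := by
      rw [hw0, Complex.ofReal_im]
    have hf : ContinuousAt (fun z : ℂ => (z - a) / (z - b)) (σ : ℂ) :=
      ContinuousAt.div (by fun_prop) (by fun_prop) hbne
    have himf : ∀ y : ℝ, ((σ + y * Complex.I - a) / (σ + y * Complex.I - b) : ℂ).im
        = y * (a - b) / Complex.normSq (σ + y * Complex.I - b) := by
      intro y
      rw [Complex.div_im]
      simp
      ring
    have hpth : Tendsto (fun y : ℝ => (σ + y * Complex.I : ℂ)) (𝓝[>] 0) (𝓝 (σ : ℂ)) := by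
      have : ContinuousAt (fun y : ℝ => (σ + y * Complex.I : ℂ)) 0 := by fun_prop
      have h2 := this.tendsto
      simp only [Complex.ofReal_zero, zero_mul, add_zero] at h2
      exact h2.mono_left nhdsWithin_le_nhds
    have hptl : Tendsto (fun y : ℝ => (σ - y * Complex.I : ℂ)) (𝓝[>] 0) (𝓝 (σ : ℂ)) := by
      have : ContinuousAt (fun y : ℝ => (σ - y * Complex.I : ℂ)) 0 := by fun_prop
      have h2 := this.tendsto
      simp only [Complex.ofReal_zero, zero_mul, sub_zero] at h2
      exact h2.mono_left nhdsWithin_le_nhds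
    have hnsq : ∀ y : ℝ, 0 < Complex.normSq (σ + y * Complex.I - b) := by
      intro y
      rw [Complex.normSq_pos]
      intro h
      have := congrArg Complex.re h
      simp at this
      linarith
    have t1 : Tendsto (fun y : ℝ => (σ + y * Complex.I - a) / (σ + y * Complex.I - b) : ℝ → ℂ)
        (𝓝[>] 0) (𝓝[{z | z.im < 0}] (((σ : ℂ) - a) / (σ - b))) := by
      refine tendsto_nhdsWithin_iff.2 ⟨hf.tendsto.comp hpth, ?_⟩
      filter_upwards [self_mem_nhdsWithin] with y hy
      show Complex.im _ < 0
      rw [himf]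
      have hy : 0 < y := hy
      exact div_neg_of_neg_of_pos (by nlinarith) (hnsq y)
    have t2 : Tendsto (fun y : ℝ => (σ - y * Complex.I - a) / (σ - y * Complex.I - b) : ℝ → ℂ)
        (𝓝[>] 0) (𝓝[{z | 0 ≤ z.im}] (((σ : ℂ) - a) / (σ - b))) := by
      refine tendsto_nhdsWithin_iff.2 ⟨hf.tendsto.comp hptl, ?_⟩
      filter_upwards [self_mem_nhdsWithin] with y hy
      show 0 ≤ Complex.im _
      have h1 := himf (-y)
      have h2 := hnsq (-y)
      push_cast at h1 h2
      rw [neg_mul, ← sub_eq_add_neg] at h1 h2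
      rw [h1]
      have hy : 0 < y := hy
      exact div_nonneg (by nlinarith) h2.le
    have l1 := (Complex.tendsto_log_nhdsWithin_im_neg_of_re_neg_of_im_zero hre him).comp t1
    have l2 := (Complex.tendsto_log_nhdsWithin_im_nonneg_of_re_neg_of_im_zero hre him).comp t2
    have g1 := (Complex.continuous_im.tendsto _).comp ((hcL.tendsto.comp hpth).sub l1)
    have g2 := (Complex.continuous_im.tendsto _).comp ((hcL.tendsto.comp hptl).sub l2)
    have e1 := tendsto_nhds_unique (tendsto_const_nhds.congr' (by
      filter_upwards [hup] with y hy using hy.symm)) g1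
    have e2 := tendsto_nhds_unique (tendsto_const_nhds.congr' (by
      filter_upwards [hlo] with y hy using hy.symm)) g2
    rw [e1] at e2
    simp at e2
    have := Real.pi_pos
    linarith

/-- boundary value of `g` from the interior -/
def HasVal (P : Set ℂ) (g : ℂ → ℝ) (z : ℂ) (k : ℝ) : Prop := ∀ᶠ w in 𝓝[interior P] z, g w = k

variable {n : ℕ} [NeZero n] {P : Set ℂ} {v : Fin n → ℂ}

lemma hasVal_open (P : Set ℂ) (g : ℂ → ℝ) (k : ℝ) : IsOpen {z | HasVal P g z k} := by
  rw [isOpen_iff_mem_nhds]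
  intro z hz
  exact eventually_nhds_nhdsWithin.2 hz

lemma Poly.hasVal_unique (h : Poly P v) {g : ℂ → ℝ} {z : ℂ} (hz : z ∈ P) {k k' : ℝ}
    (h1 : HasVal P g z k) (h2 : HasVal P g z k') : k = k' := by
  have : z ∈ closure (interior P) := by rw [← h.2.2.2.2.1]; exact hz
  have hne : (𝓝[interior P] z).NeBot := mem_closure_iff_nhdsWithin_neBot.1 this
  obtain ⟨w, hw1, hw2⟩ := (h1.and h2).exists
  rw [← hw1, ← hw2]

lemma Poly.hasVal_exists (h : Poly P v) {g : ℂ → ℝ} {K : Set ℂ} (hK : IsClosed K)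
    (hg : ∀ S, IsPreconnected S → (∀ z ∈ S, z ∉ frontier P ∧ z ∉ K) →
        ∀ x ∈ S, ∀ y ∈ S, g x = g y) {z : ℂ} (hz : z ∈ P) (hzK : z ∉ K) :
    ∃ k, HasVal P g z k := by
  obtain ⟨ε0, hε0, H⟩ := h.local_conn hz
  obtain ⟨e1, he1, H1⟩ := Metric.isOpen_iff.1 hK.isOpen_compl z hzK
  have hpos := lt_min hε0 he1
  have hpre := (H (min ε0 e1) hpos (min_le_left _ _)).1
  have hzc : z ∈ closure (interior P) := by rw [← h.2.2.2.2.1]; exact hz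
  obtain ⟨x, hx, hd⟩ := Metric.mem_closure_iff.1 hzc _ hpos
  refine ⟨g x, ?_⟩
  filter_upwards [self_mem_nhdsWithin, mem_nhdsWithin_of_mem_nhds (Metric.ball_mem_nhds z hpos)]
    with w hw1 hw2
  refine hg _ hpre ?_ w ⟨hw2, hw1⟩ x ⟨by rwa [Metric.mem_ball, dist_comm], hx⟩
  rintro u ⟨hu1, hu2⟩
  exact ⟨fun hF => hF.2 hu2, H1 (Metric.ball_subset_ball (min_le_right _ _) hu1)⟩

lemma Poly.hasVal_const (h : Poly P v) {g : ℂ → ℝ} {K : Set ℂ} (hK : IsClosed K)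
    (hg : ∀ S, IsPreconnected S → (∀ z ∈ S, z ∉ frontier P ∧ z ∉ K) →
        ∀ x ∈ S, ∀ y ∈ S, g x = g y) {D : Set ℂ} (hD : IsPreconnected D)
    (hDP : ∀ z ∈ D, z ∈ P ∧ z ∉ K) {x y : ℂ} (hx : x ∈ D) (hy : y ∈ D) {k : ℝ}
    (hxk : HasVal P g x k) : HasVal P g y k := by
  obtain ⟨k', hk'⟩ := h.hasVal_exists hK hg (hDP y hy).1 (hDP y hy).2
  by_cases hkk : k' = k
  · rwa [hkk] at hk'
  exfalso
  have hO2 : IsOpen (⋃ j ∈ {j : ℝ | j ≠ k}, {z | HasVal P g z j}) :=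
    isOpen_biUnion fun j _ => hasVal_open P g j
  obtain ⟨z, hz, hz1, hz2⟩ := hD _ _ (hasVal_open P g k) hO2 (by
    intro z hz
    obtain ⟨j, hj⟩ := h.hasVal_exists hK hg (hDP z hz).1 (hDP z hz).2
    by_cases hjk : j = k
    · left; rw [hjk] at hj; exact hj
    · right; exact mem_biUnion (show j ∈ {j : ℝ | j ≠ k} from hjk) hj) ⟨x, hx, hxk⟩
    ⟨y, hy, mem_biUnion (show k' ∈ {j : ℝ | j ≠ k} from hkk) hk'⟩
  simp only [mem_iUnion] at hz2
  obtain ⟨j, hj, hz2⟩ := hz2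
  exact hj (h.hasVal_unique (hDP z hz).1 hz2 hz1)

end partC

end Pocket

namespace Pocket

section partD
open Set Filter Topology

variable {n : ℕ} [NeZero n] {P : Set ℂ} {v : Fin n → ℂ}

/-- open upper half plane -/
def Up : Set ℂ := {z | 0 < z.im}

lemma up_open : IsOpen Up := isOpen_lt continuous_const Complex.continuous_im

/-- a small closed upper half disc at `σ` lies in `P` -/
def Good (P : Set ℂ) (σ : ℝ) : Prop := ∀ᶠ z in 𝓝 (σ : ℂ), 0 ≤ z.im → z ∈ P

lemma good_open (P : Set ℂ) : IsOpen {σ : ℝ | Good P σ} := by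
  have : IsOpen {w : ℂ | ∀ᶠ z in 𝓝 w, 0 ≤ z.im → z ∈ P} := by
    rw [isOpen_iff_mem_nhds]
    intro w hw
    exact eventually_eventually_nhds.2 hw
  exact this.preimage Complex.continuous_ofReal

lemma good_mem {σ : ℝ} (h : Good P σ) : (σ : ℂ) ∈ P := by
  exact h.self_of_nhds (by simp)

lemma mem_rseg {a b : ℝ} (hab : a ≤ b) {z : ℂ} :
    z ∈ segment ℝ (a : ℂ) (b : ℂ) ↔ z.im = 0 ∧ a ≤ z.re ∧ z.re ≤ b := by
  have := image_segment ℝ (Complex.ofRealCLM.toLinearMap.toAffineMap) a b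
  simp at this
  rw [← this, segment_eq_Icc hab]
  constructor
  · rintro ⟨t, ht, rfl⟩
    exact ⟨by simp, by simpa using ht⟩
  · rintro ⟨h0, h1⟩
    exact ⟨z.re, h1, by apply Complex.ext <;> simp [h0]⟩

lemma real_of_im {z : ℂ} (h : z.im = 0) : z = ((z.re : ℝ) : ℂ) := by
  apply Complex.ext <;> simp [h]

lemma mem_ball_real {x τ ε : ℝ} (h : |τ - x| < ε) : (τ : ℂ) ∈ Metric.ball (x : ℂ) ε := by
  rw [mem_ball_iff_norm, ← Complex.ofReal_sub, Complex.norm_real]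
  exact h

lemma Poly.tip (h : Poly P v) {x τ : ℝ} (hx : 0 < x) (hτ : x < τ)
    (hseg : segment ℝ (0 : ℂ) τ ⊆ P) (hng : ¬ Good P x) :
    (∃ ε > 0, ∀ w ∈ Metric.ball (x : ℂ) ε, w.im ≤ 0 → w ∈ P) ∧
    ∃ e : ℂ, 0 < e.im ∧ ∀ t : ℝ, 0 < t → t ≤ 1 → (x : ℂ) + t • (e - x) ∉ P := by
  have hreal : ∀ z : ℂ, z.im = 0 → 0 ≤ z.re → z.re ≤ τ → z ∈ P := by
    intro z h1 h2 h3
    apply hseg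
    have := (mem_rseg (z := z) (hx.trans hτ).le).2 ⟨h1, h2, h3⟩
    simpa using this
  have hxP : (x : ℂ) ∈ P := hreal x (by simp) (by simpa using hx.le) (by simpa using hτ.le)
  obtain ⟨ε0, hε0, H⟩ := h.local_conn hxP
  obtain ⟨e1, he1, H1⟩ := h.cone (x : ℂ)
  set ε := min (min ε0 e1) (min x (τ - x)) with hε
  have hεpos : 0 < ε := lt_min (lt_min hε0 he1) (lt_min hx (by linarith))
  have hεx : ε ≤ x := (min_le_right _ _).trans (min_le_left _ _)
  have hετ : ε ≤ τ - x := (min_le_right _ _).trans (min_le_right _ _)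
  have hpre := (H ε hεpos ((min_le_left _ _).trans (min_le_left _ _))).2
  have hballreal : ∀ z ∈ Metric.ball (x : ℂ) ε, z.im = 0 → z ∈ P := by
    intro z hz hz0
    have h1 : |z.re - x| < ε := by
      rw [mem_ball_iff_norm] at hz
      have := Complex.abs_re_le_norm (z - x)
      simp at this
      linarith
    rw [abs_lt] at h1
    exact hreal z hz0 (by linarith) (by linarith)
  obtain ⟨e, heb, heim, heP⟩ : ∃ e ∈ Metric.ball (x : ℂ) ε, 0 < e.im ∧ e ∉ P := by
    by_contra hcon
    push Not at hcon
    apply hng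
    filter_upwards [Metric.ball_mem_nhds (x : ℂ) hεpos] with z hz hz0
    rcases hz0.eq_or_lt with h0 | h0
    · exact hballreal z hz h0.symm
    · exact hcon z hz h0
  refine ⟨⟨ε, hεpos, fun w hw hw0 => ?_⟩, e, heim, fun t h0 h1 => ?_⟩
  · by_contra hwP
    obtain ⟨u, hu, hu0⟩ := hpre.intermediate_value (a := w) (b := e) ⟨hw, hwP⟩ ⟨heb, heP⟩
      Complex.continuous_im.continuousOn (show (0 : ℝ) ∈ Icc w.im e.im from ⟨hw0, heim.le⟩)
    exact hu.2 (hballreal u hu.1 hu0)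
  · rw [H1 e (Metric.ball_subset_ball ((min_le_left _ _).trans (min_le_right _ _)) heb) t h0 h1]
    exact heP

lemma gap_invis {x σ : ℝ} (hx : 0 < x) (hσ : x < σ) {e : ℂ} (he : 0 < e.im)
    (hE : ∀ t : ℝ, 0 < t → t ≤ 1 → (x : ℂ) + t • (e - x) ∉ P) :
    ∀ᶠ z in 𝓝 (σ : ℂ), 0 < z.im → z ∉ Vis P 0 := by
  have hσ0 : 0 < σ := hx.trans hσ
  have c1 : ContinuousAt (fun z : ℂ => x / (z.re - z.im * (e.re - x) / e.im)) (σ : ℂ) := by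
    refine ContinuousAt.div (by fun_prop) ?_ (by simpa using hσ0.ne')
    exact (Complex.continuous_re.continuousAt).sub
      (((Complex.continuous_im.continuousAt).mul continuousAt_const).div_const _)
  have c2 : ContinuousAt (fun z : ℂ => (z.re - z.im * (e.re - x) / e.im)) (σ : ℂ) := by
    exact (Complex.continuous_re.continuousAt).sub
      (((Complex.continuous_im.continuousAt).mul continuousAt_const).div_const _)
  have c3 : ContinuousAt (fun z : ℂ => x / (z.re - z.im * (e.re - x) / e.im) * z.im / e.im) (σ : ℂ) :=
    (c1.mul Complex.continuous_im.continuousAt).div_const _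
  have v1 : x / (((σ : ℂ)).re - ((σ : ℂ)).im * (e.re - x) / e.im) < 1 := by
    simp; rw [div_lt_one hσ0]; exact hσ
  have v2 : 0 < (((σ : ℂ)).re - ((σ : ℂ)).im * (e.re - x) / e.im) := by simpa using hσ0
  have v3 : x / (((σ : ℂ)).re - ((σ : ℂ)).im * (e.re - x) / e.im) * (σ : ℂ).im / e.im < 1 := by simp
  filter_upwards [c1.eventually (gt_mem_nhds v1), c2.eventually (lt_mem_nhds v2),
    c3.eventually (gt_mem_nhds v3)] with z h1 h2 h3 hz hV
  set D := z.re - z.im * (e.re - x) / e.im with hD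
  set l := x / D with hl
  have hl0 : 0 < l := div_pos hx h2
  set t := l * z.im / e.im with ht
  have ht0 : 0 < t := by positivity
  refine hE t ht0 h3.le ?_
  have hmem : (x : ℂ) + t • (e - x) = 0 + l • (z - 0) := by
    have hlD : l * D = x := div_mul_cancel₀ _ h2.ne'
    have hte : t * e.im = l * z.im := by rw [ht]; field_simp
    apply Complex.ext
    · simp
      have : l * D = l * z.re - t * (e.re - x) := by
        rw [hD, ht]; field_simp
      linarith
    · simp
      linarith
  rw [hmem]
  exact hV.2 (mem_seg_iff.2 ⟨l, hl0.le, h1.le, rfl⟩)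

lemma tendsto_up (σ : ℝ) : Tendsto (fun y : ℝ => (σ + y * Complex.I : ℂ)) (𝓝[>] 0) (𝓝 (σ : ℂ)) := by
  have : ContinuousAt (fun y : ℝ => (σ + y * Complex.I : ℂ)) 0 := by fun_prop
  have h2 := this.tendsto
  simp only [Complex.ofReal_zero, zero_mul, add_zero] at h2
  exact h2.mono_left nhdsWithin_le_nhds

lemma tendsto_down (σ : ℝ) :
    Tendsto (fun y : ℝ => (σ - y * Complex.I : ℂ)) (𝓝[>] 0) (𝓝 (σ : ℂ)) := by
  have : ContinuousAt (fun y : ℝ => (σ - y * Complex.I : ℂ)) 0 := by fun_prop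
  have h2 := this.tendsto
  simp only [Complex.ofReal_zero, zero_mul, sub_zero] at h2
  exact h2.mono_left nhdsWithin_le_nhds

lemma up_neBot (σ : ℝ) : (𝓝[Up] (σ : ℂ)).NeBot := by
  have : Tendsto (fun y : ℝ => (σ + y * Complex.I : ℂ)) (𝓝[>] 0) (𝓝[Up] (σ : ℂ)) := by
    refine tendsto_nhdsWithin_iff.2 ⟨tendsto_up σ, ?_⟩
    filter_upwards [self_mem_nhdsWithin] with y hy
    show 0 < Complex.im _
    simpa using hy
  exact this.neBot

/-- Somewhere before a good point adjacent to the pocket there is a bad point. -/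
lemma Poly.exists_bad (h : Poly P v) (h0 : (0 : ℂ) ∈ P) {s : ℝ} (hs : 0 < s) {C : Set ℂ}
    (hCV : ∀ z ∈ C, z ∉ Vis P 0) (hsC : (s : ℂ) ∈ closure (C ∩ Up)) :
    ∃ σ, 0 < σ ∧ σ ≤ s ∧ ¬ Good P σ := by
  by_contra hcon
  push Not at hcon
  obtain ⟨ε, hε, H⟩ := h.cone 0
  set δ := min 1 (ε / (2 * s)) with hδ
  have hδ0 : 0 < δ := lt_min one_pos (by positivity)
  have hδs : δ * (2 * s) ≤ ε := by
    have : δ ≤ ε / (2 * s) := min_le_right _ _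
    rwa [le_div_iff₀ (by positivity)] at this
  have hK : ∀ᶠ z in 𝓝 (s : ℂ), ∀ l ∈ Icc δ 1, 0 ≤ z.im → (l : ℂ) * z ∈ P := by
    refine isCompact_Icc.eventually_forall_of_forall_eventually fun l hl => ?_
    have hl0 : 0 < l := hδ0.trans_le hl.1
    have hg := hcon (l * s) (by positivity) (by nlinarith [hl.2])
    have hc : ContinuousAt (fun x : ℂ × ℝ => (x.2 : ℂ) * x.1) ((s : ℂ), l) := by fun_prop
    have hg' : ∀ᶠ z in 𝓝 ((l : ℂ) * (s : ℂ)), 0 ≤ z.im → z ∈ P := by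
      have := hg; unfold Good at this; push_cast at this; exact this
    have e1 := hc.eventually hg'
    have e2 : ∀ᶠ x : ℂ × ℝ in 𝓝 ((s : ℂ), l), 0 < x.2 :=
      (continuous_snd.continuousAt (x := ((s : ℂ), l))).eventually (lt_mem_nhds hl0)
    filter_upwards [e1, e2] with x hx1 hx2 hx3
    refine hx1 ?_
    simp
    positivity
  have hn : ∀ᶠ z in 𝓝 (s : ℂ), ‖z‖ < 2 * s :=
    (continuous_norm.continuousAt (x := (s : ℂ))).eventually (gt_mem_nhds (by
      simp only [Complex.norm_real, Real.norm_of_nonneg hs.le]; linarith))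
  obtain ⟨z, ⟨hzC, hzU⟩, hz1, hz2⟩ :=
    ((mem_closure_iff_frequently.1 hsC).and_eventually (hK.and hn)).exists
  have hzim : 0 ≤ z.im := le_of_lt hzU
  refine hCV z hzC ⟨by simpa using hz1 1 ⟨min_le_left _ _, le_rfl⟩ hzim, fun u hu => ?_⟩
  obtain ⟨t, ht0, ht1, rfl⟩ := mem_seg_iff.1 hu
  rw [sub_zero, zero_add, Complex.real_smul]
  rcases le_total δ t with hle | hle
  · exact hz1 t ⟨hle, ht1⟩ hzim
  rcases ht0.eq_or_lt with h' | h'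
  · rw [← h']; simpa using h0
  have hdz := hz1 δ ⟨le_rfl, min_le_left _ _⟩ hzim
  have hb : (δ : ℂ) * z ∈ Metric.ball (0 : ℂ) ε := by
    rw [mem_ball_zero_iff, norm_mul, Complex.norm_real, Real.norm_of_nonneg hδ0.le]
    nlinarith
  have := (H _ hb (t / δ) (by positivity) (by rw [div_le_one hδ0]; exact hle)).2 hdz
  rw [sub_zero, zero_add, Complex.real_smul] at this
  convert this using 1
  push_cast
  have : (δ : ℂ) ≠ 0 := by exact_mod_cast hδ0.ne'
  field_simp

lemma good_up_interior {σ : ℝ} (hg : Good P σ) : ∀ᶠ z in 𝓝 (σ : ℂ), 0 < z.im → z ∈ interior P := by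
  have := eventually_eventually_nhds.2 hg
  filter_upwards [this] with z hz hz0
  rw [mem_interior_iff_mem_nhds]
  filter_upwards [hz, up_open.mem_nhds (show z ∈ Up from hz0)] with w h1 h2
  exact h1 (le_of_lt h2)

theorem Poly.gap_main (h : Poly P v) (h0 : (0 : ℂ) ∈ P) {C : Set ℂ} {x0 : ℂ}
    (hC : C = connectedComponentIn (P \ Vis P 0) x0)
    {s : ℝ} (hs : 0 < s) (hsV : (s : ℂ) ∈ Vis P 0) (hsG : Good P s)
    (hsC : (s : ℂ) ∈ closure (C ∩ Up)) :
    ∃ x ∈ P, ∃ y ∈ P, closure C ∩ Vis P 0 = segment ℝ x y := by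
  have hCP : C ⊆ P \ Vis P 0 := by rw [hC]; exact connectedComponentIn_subset _ _
  have hCpre : IsPreconnected C := by rw [hC]; exact isPreconnected_connectedComponentIn
  have hclP : closure C ⊆ P := closure_minimal (fun z hz => (hCP hz).1) h.closed
  have habsorb : ∀ S : Set ℂ, IsPreconnected S → S ⊆ P \ Vis P 0 → (S ∩ C).Nonempty → S ⊆ C := by
    rintro S hS hSP ⟨z, hzS, hzC⟩
    rw [hC] at hzC
    rw [hC, connectedComponentIn_eq hzC]
    exact hS.subset_connectedComponentIn hzS hSP
  have hbadcl : IsClosed {σ : ℝ | ¬ Good P σ} := (good_open P).isClosed_compl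
  -- the lower end of the gap
  obtain ⟨σ0, hσ0, hσs, hσb⟩ := h.exists_bad h0 hs (fun z hz => (hCP hz).2) hsC
  obtain ⟨a, ⟨⟨ha0', has'⟩, hab'⟩, hamax⟩ := (isCompact_Icc.inter_right hbadcl).exists_isGreatest
    (s := Icc 0 s ∩ {σ : ℝ | ¬ Good P σ}) ⟨σ0, ⟨hσ0.le, hσs⟩, hσb⟩
  have ha0 : 0 < a := hσ0.trans_le (hamax ⟨⟨hσ0.le, hσs⟩, hσb⟩)
  have haB : ¬ Good P a := hab'
  have has : a < s := lt_of_le_of_ne has' fun e => haB (e ▸ hsG)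
  -- the upper end of the gap
  obtain ⟨R, hR⟩ := h.2.2.1.isBounded.subset_ball (0 : ℂ)
  have hRbad : ¬ Good P (max s R) := by
    intro hg
    have := hR (good_mem hg)
    rw [mem_ball_zero_iff, Complex.norm_real, Real.norm_eq_abs] at this
    have h1 := le_abs_self (max s R)
    have h2 := le_max_right s R
    linarith
  obtain ⟨b, ⟨⟨hsb', hbR⟩, hbB'⟩, hbmin⟩ := (isCompact_Icc.inter_right hbadcl).exists_isLeast
    (s := Icc s (max s R) ∩ {σ : ℝ | ¬ Good P σ}) ⟨max s R, ⟨le_max_left _ _, le_rfl⟩, hRbad⟩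
  have hbB : ¬ Good P b := hbB'
  have hsb : s < b := lt_of_le_of_ne hsb' fun e => hbB (e ▸ hsG)
  have hab : a < b := has.trans hsb
  have hgood : ∀ σ, a < σ → σ < b → Good P σ := by
    intro σ h1 h2
    by_contra hng
    rcases le_total σ s with h3 | h3
    · exact absurd (hamax ⟨⟨(ha0.trans h1).le, h3⟩, hng⟩) (not_le.2 h1)
    · exact absurd (hbmin ⟨⟨h3, h2.le.trans hbR⟩, hng⟩) (not_le.2 h2)
  -- the visible part of the ray
  have hrealP : ∀ σ : ℝ, 0 ≤ σ → σ ≤ b → (σ : ℂ) ∈ P := by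
    intro σ h1 h2
    rcases le_or_gt σ s with h3 | h3
    · apply hsV.2
      have := (mem_rseg (z := (σ : ℂ)) hs.le).2 ⟨by simp, by simpa using h1, by simpa using h3⟩
      simpa using this
    · have hcl : IsClosed ((fun t : ℝ => (t : ℂ)) ⁻¹' P) := h.closed.preimage Complex.continuous_ofReal
      have : Icc s b ⊆ (fun t : ℝ => (t : ℂ)) ⁻¹' P := by
        rw [← closure_Ioo hsb.ne]
        refine closure_minimal (fun t ht => good_mem (hgood t (has.trans ht.1) ht.2)) hcl
      exact this ⟨h3.le, h2⟩
  have hsegP : ∀ σ : ℝ, 0 ≤ σ → σ ≤ b → segment ℝ (0 : ℂ) σ ⊆ P := by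
    intro σ h1 h2 z hz
    have := (mem_rseg (z := z) h1).1 (by simpa using hz)
    rw [real_of_im this.1]
    exact hrealP _ this.2.1 (this.2.2.trans h2)
  have hVis : ∀ σ : ℝ, 0 ≤ σ → σ ≤ b → (σ : ℂ) ∈ Vis P 0 := fun σ h1 h2 =>
    ⟨hrealP σ h1 h2, hsegP σ h1 h2⟩
  have hKV : segment ℝ (a : ℂ) (b : ℂ) ⊆ Vis P 0 := by
    intro z hz
    rw [mem_rseg hab.le] at hz
    rw [real_of_im hz.1]
    exact hVis _ (ha0.le.trans hz.2.1) hz.2.2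
  have hfr : ∀ σ : ℝ, 0 ≤ σ → σ ≤ b → ¬ Good P σ → (σ : ℂ) ∈ frontier P := by
    intro σ h1 h2 hng
    refine ⟨subset_closure (hrealP σ h1 h2), fun hi => hng ?_⟩
    rw [mem_interior_iff_mem_nhds] at hi
    filter_upwards [hi] with z hz _ using hz
  have haF := hfr a ha0.le hab.le haB
  have hbF := hfr b (ha0.trans hab).le le_rfl hbB
  -- tip at a
  obtain ⟨⟨εa, hεa, Ha⟩, e, he, hE⟩ := h.tip ha0 hab (hsegP b (ha0.trans hab).le le_rfl) haB
  -- strip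
  have hstrip : ∀ σ, a < σ → σ < b → ∀ᶠ z in 𝓝[Up] (σ : ℂ), z ∈ P \ Vis P 0 := by
    intro σ h1 h2
    rw [eventually_nhdsWithin_iff]
    filter_upwards [hgood σ h1 h2, gap_invis ha0 h1 he hE] with z hz1 hz2 hzU
    exact ⟨hz1 (le_of_lt hzU), hz2 hzU⟩
  have hQ : ∀ σ, a < σ → σ < b → ∀ᶠ z in 𝓝[Up] (σ : ℂ), z ∈ C := by
    have hop : ∀ T : Set ℂ, IsOpen {σ : ℝ | ∀ᶠ z in 𝓝[Up] (σ : ℂ), z ∈ T} := by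
      intro T
      have : IsOpen {w : ℂ | ∀ᶠ z in 𝓝[Up] w, z ∈ T} := by
        rw [isOpen_iff_mem_nhds]
        intro w hw
        exact eventually_nhds_nhdsWithin.2 hw
      exact this.preimage Complex.continuous_ofReal
    have hdich : ∀ σ, a < σ → σ < b → (∀ᶠ z in 𝓝[Up] (σ : ℂ), z ∈ C) ∨
        (∀ᶠ z in 𝓝[Up] (σ : ℂ), z ∈ Cᶜ) := by
      intro σ h1 h2
      have hst := hstrip σ h1 h2
      rw [eventually_nhdsWithin_iff, Metric.eventually_nhds_iff_ball] at hst
      obtain ⟨r, hr, H⟩ := hst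
      have hconv : Convex ℝ (Metric.ball (σ : ℂ) r ∩ Up) :=
        (convex_ball _ _).inter (convex_halfSpace_im_gt 0)
      by_cases hne : ((Metric.ball (σ : ℂ) r ∩ Up) ∩ C).Nonempty
      · left
        have := habsorb _ hconv.isPreconnected (fun z hz => H z hz.1 hz.2) hne
        filter_upwards [self_mem_nhdsWithin, mem_nhdsWithin_of_mem_nhds
          (Metric.ball_mem_nhds (σ : ℂ) hr)] with z hz1 hz2 using this ⟨hz2, hz1⟩
      · right
        filter_upwards [self_mem_nhdsWithin, mem_nhdsWithin_of_mem_nhds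
          (Metric.ball_mem_nhds (σ : ℂ) hr)] with z hz1 hz2 hzC
        exact hne ⟨z, ⟨hz2, hz1⟩, hzC⟩
    have hno : ∀ σ : ℝ, (∀ᶠ z in 𝓝[Up] (σ : ℂ), z ∈ C) → (∀ᶠ z in 𝓝[Up] (σ : ℂ), z ∈ Cᶜ) → False := by
      intro σ h1 h2
      have := up_neBot σ
      obtain ⟨z, hz1, hz2⟩ := (h1.and h2).exists
      exact hz2 hz1
    have hsQ : ∀ᶠ z in 𝓝[Up] (s : ℂ), z ∈ C := by
      rcases hdich s has hsb with h1 | h1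
      · exact h1
      · exfalso
        rw [eventually_nhdsWithin_iff] at h1
        obtain ⟨z, hz, hz2⟩ := ((mem_closure_iff_frequently.1 hsC).and_eventually h1).exists
        exact hz2 hz.2 hz.1
    intro σ h1 h2
    rcases hdich σ h1 h2 with h3 | h3
    · exact h3
    exfalso
    obtain ⟨τ, -, hτ1, hτ2⟩ := (isPreconnected_Ioo : IsPreconnected (Ioo a b)) _ _ (hop C) (hop Cᶜ)
      (fun τ hτ => hdich τ hτ.1 hτ.2) ⟨s, ⟨has, hsb⟩, hsQ⟩ ⟨σ, ⟨h1, h2⟩, h3⟩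
    exact hno τ hτ1 hτ2
  -- [a,b] in closure C
  have hsubC : ∀ σ : ℝ, a ≤ σ → σ ≤ b → (σ : ℂ) ∈ closure C := by
    have hcl : IsClosed ((fun t : ℝ => (t : ℂ)) ⁻¹' closure C) :=
      isClosed_closure.preimage Complex.continuous_ofReal
    have : Icc a b ⊆ (fun t : ℝ => (t : ℂ)) ⁻¹' closure C := by
      rw [← closure_Ioo hab.ne]
      refine closure_minimal (fun t ht => ?_) hcl
      have hq := hQ t ht.1 ht.2
      have := up_neBot t
      exact mem_closure_iff_frequently.2 (hq.frequently.filter_mono nhdsWithin_le_nhds)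
    exact fun σ h1 h2 => this ⟨h1, h2⟩
  -- separating function
  obtain ⟨g, hg, hjump⟩ := sep (isClosed_frontier (s := P)) haF hbF (h.chain haF hbF)
  have hKcl : IsClosed (segment ℝ (a : ℂ) (b : ℂ)) := isClosed_seg _ _
  have hCK : ∀ z ∈ C, z ∈ P ∧ z ∉ segment ℝ (a : ℂ) (b : ℂ) :=
    fun z hz => ⟨(hCP hz).1, fun hh => (hCP hz).2 (hKV hh)⟩
  obtain ⟨xc, hxc⟩ : C.Nonempty := by
    obtain ⟨z, hz, -⟩ := (mem_closure_iff_frequently.1 hsC).exists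
    exact ⟨z, hz⟩
  obtain ⟨k, hk⟩ := h.hasVal_exists hKcl hg (hCK xc hxc).1 (hCK xc hxc).2
  have hCk : ∀ z ∈ C, HasVal P g z k := fun z hz => h.hasVal_const hKcl hg hCpre hCK hxc hz hk
  have hupper : ∀ σ : ℝ, a < σ → σ < b → ∀ᶠ y : ℝ in 𝓝[>] 0, g (σ + y * Complex.I) = k := by
    intro σ h1 h2
    have e1 := hQ σ h1 h2
    rw [eventually_nhdsWithin_iff] at e1
    filter_upwards [(tendsto_up σ).eventually e1,
      (tendsto_up σ).eventually (good_up_interior (hgood σ h1 h2)), self_mem_nhdsWithin] with y hy1 hy2 hy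
    have hyU : 0 < (σ + y * Complex.I : ℂ).im := by simpa using hy
    exact (hCk _ (hy1 hyU)).self_of_nhdsWithin (hy2 hyU)
  have hJ : ∀ x ε : ℝ, (∀ w ∈ Metric.ball (x : ℂ) ε, w.im ≤ 0 → w ∈ P) → ∀ τ τ' : ℝ,
      |τ - x| < ε → |τ' - x| < ε → a < τ → τ < b → HasVal P g τ' k → False := by
    intro x ε hlow τ τ' hτ hτ' h1 h2 hval
    set S := Metric.ball (x : ℂ) ε ∩ {w : ℂ | w.im < 0} with hS
    have hSo : IsOpen S := Metric.isOpen_ball.inter (isOpen_lt Complex.continuous_im continuous_const)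
    have hSi : S ⊆ interior P := hSo.subset_interior_iff.2 fun w hw => hlow w hw.1 (le_of_lt hw.2)
    have hSpre : IsPreconnected S :=
      ((convex_ball _ _).inter (convex_halfSpace_im_lt 0)).isPreconnected
    have hconst := hg S hSpre (fun z hz => ⟨fun hF => hF.2 (hSi hz), fun hK => by
      rw [mem_rseg hab.le] at hK
      exact absurd hK.1 (ne_of_lt hz.2)⟩)
    have hdown : ∀ t : ℝ, |t - x| < ε → ∀ᶠ y : ℝ in 𝓝[>] 0, (t - y * Complex.I : ℂ) ∈ S := by
      intro t ht
      filter_upwards [(tendsto_down t).eventually (Metric.isOpen_ball.mem_nhds (mem_ball_real ht)),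
        self_mem_nhdsWithin] with y hy1 hy2
      exact ⟨hy1, by show Complex.im _ < 0; simpa using hy2⟩
    have ht' : Tendsto (fun y : ℝ => (τ' - y * Complex.I : ℂ)) (𝓝[>] 0) (𝓝[interior P] (τ' : ℂ)) :=
      tendsto_nhdsWithin_iff.2 ⟨tendsto_down τ', by
        filter_upwards [hdown τ' hτ'] with y hy using hSi hy⟩
    obtain ⟨y0, hy0, hy0S⟩ := ((ht'.eventually hval).and (hdown τ' hτ')).exists
    have hτi : (τ : ℂ) ∈ interior P := by
      rw [mem_interior_iff_mem_nhds]
      filter_upwards [hgood τ h1 h2, Metric.isOpen_ball.mem_nhds (mem_ball_real hτ)] with w hw1 hw2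
      rcases le_total 0 w.im with h3 | h3
      · exact hw1 h3
      · exact hlow w hw2 h3
    refine hjump τ h1 h2 (fun hF => hF.2 hτi) k (hupper τ h1 h2) ?_
    filter_upwards [hdown τ hτ] with y hy
    rw [hconst _ hy _ hy0S, hy0]
  refine ⟨a, hrealP a ha0.le hab.le, b, hrealP b (ha0.trans hab).le le_rfl, ?_⟩
  apply Subset.antisymm
  · rintro z ⟨hzC, hzV⟩
    by_contra hzK
    have hzk : HasVal P g z k := by
      obtain ⟨k', hk'⟩ := h.hasVal_exists hKcl hg hzV.1 hzK
      obtain ⟨w, hw1, hw2⟩ := mem_closure_iff.1 hzC _ (hasVal_open P g k') hk'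
      have := h.hasVal_unique (hCP hw2).1 hw1 (hCk w hw2)
      rwa [this] at hk'
    by_cases hcase : ∃ w ∈ segment ℝ (0 : ℂ) z, w ∈ segment ℝ (a : ℂ) (b : ℂ)
    · obtain ⟨w, hw, hwK⟩ := hcase
      rw [mem_rseg hab.le] at hwK
      obtain ⟨t, ht0, ht1, rfl⟩ := mem_seg_iff.1 hw
      simp at hwK
      obtain ⟨hw1, hw2, hw3⟩ := hwK
      have htpos : 0 < t := by
        rcases ht0.eq_or_lt with h | h
        · rw [← h] at hw2; linarith
        · exact h
      have hzim : z.im = 0 := by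
        rcases hw1 with h | h
        · exact absurd h htpos.ne'
        · exact h
      have hzre0 : 0 < z.re := by
        by_contra hc
        push Not at hc
        nlinarith
      have hza : a ≤ z.re := by nlinarith
      have hzb : b < z.re := by
        by_contra hc
        push Not at hc
        exact hzK ((mem_rseg hab.le).2 ⟨hzim, hza, hc⟩)
      have hzeq := real_of_im hzim
      obtain ⟨⟨ε, hε, Hb⟩, -⟩ := h.tip (ha0.trans hab) hzb (by rw [← hzeq]; exact hzV.2) hbB
      set m := min ε (min (b - a) (z.re - b)) with hm
      have hm0 : 0 < m := lt_min hε (lt_min (by linarith) (by linarith))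
      have hm1 : m ≤ ε := min_le_left _ _
      have hm2 : m ≤ b - a := (min_le_right _ _).trans (min_le_left _ _)
      have hm3 : m ≤ z.re - b := (min_le_right _ _).trans (min_le_right _ _)
      refine hJ b ε Hb (b - m / 2) (b + m / 2) (by rw [abs_lt]; constructor <;> linarith)
        (by rw [abs_lt]; constructor <;> linarith) (by linarith) (by linarith) ?_
      have hle : b + m / 2 ≤ z.re := by linarith
      refine h.hasVal_const hKcl hg (D := segment ℝ ((b + m / 2 : ℝ) : ℂ) ((z.re : ℝ) : ℂ))
        (convex_segment _ _).isPreconnected ?_ (by rw [← hzeq]; exact right_mem_segment _ _ _)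
        (left_mem_segment _ _ _) hzk
      intro u hu
      rw [mem_rseg hle] at hu
      refine ⟨?_, fun hK => ?_⟩
      · apply hzV.2
        rw [hzeq]
        have := (mem_rseg (z := u) hzre0.le).2 ⟨hu.1, by linarith [hu.2.1, ha0, hab], hu.2.2⟩
        simpa using this
      · rw [mem_rseg hab.le] at hK
        linarith [hK.2.2, hu.2.1]
    · push Not at hcase
      set m := min εa (min (b - a) a) with hm
      have hm0 : 0 < m := lt_min hεa (lt_min (by linarith) ha0)
      have hm1 : m ≤ εa := min_le_left _ _
      have hm2 : m ≤ b - a := (min_le_right _ _).trans (min_le_left _ _)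
      have hm3 : m ≤ a := (min_le_right _ _).trans (min_le_right _ _)
      refine hJ a εa Ha (a + m / 2) (a - m / 2) (by rw [abs_lt]; constructor <;> linarith)
        (by rw [abs_lt]; constructor <;> linarith) (by linarith) (by linarith) ?_
      have hle : 0 ≤ a - m / 2 := by linarith
      refine h.hasVal_const hKcl hg (D := segment ℝ (0 : ℂ) z ∪ segment ℝ (0 : ℂ) ((a - m / 2 : ℝ) : ℂ))
        ((convex_segment _ _).isPreconnected.union 0 (left_mem_segment _ _ _) (left_mem_segment _ _ _)
          (convex_segment _ _).isPreconnected) ?_ (Or.inl (right_mem_segment _ _ _))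
        (Or.inr (right_mem_segment _ _ _)) hzk
      rintro u (hu | hu)
      · exact ⟨hzV.2 hu, hcase u hu⟩
      · refine ⟨hsegP _ hle (by linarith) hu, fun hK => ?_⟩
        rw [mem_rseg hab.le] at hK
        have := (mem_rseg (z := u) hle).1 (by simpa using hu)
        linarith [hK.2.1, this.2.2]
  · intro z hz
    refine ⟨?_, hKV hz⟩
    rw [mem_rseg hab.le] at hz
    rw [real_of_im hz.1]
    exact hsubC _ hz.2.1 hz.2.2

end partD

end Pocket

namespace Pocket

section partE
open Set Filter Topology

variable {n : ℕ} [NeZero n] {P : Set ℂ} {v : Fin n → ℂ}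

lemma dich (hseg : segment ℝ (0 : ℂ) 1 ⊆ P) {ε : ℝ} (hε1 : ε ≤ 1)
    (hcone : ∀ z ∈ Metric.ball (1 : ℂ) ε, ∀ t : ℝ, 0 < t → t ≤ 1 → (1 + t • (z - 1) ∈ P ↔ z ∈ P))
    (hpre : IsPreconnected (Metric.ball (1 : ℂ) ε ∩ Pᶜ))
    {w : ℂ} (hwP : w ∈ P) (hwU : 0 < w.im) (hwB : w ∈ Metric.ball (1 : ℂ) ε) :
    (∀ l : ℝ, 0 < l → l < 1 → (l : ℂ) * w ∈ Metric.ball (1 : ℂ) ε → (l : ℂ) * w ∈ P) ∨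
    (∀ l : ℝ, 1 < l → (l : ℂ) * w ∈ Metric.ball (1 : ℂ) ε → (l : ℂ) * w ∈ P) := by
  by_contra hcon
  push Not at hcon
  obtain ⟨⟨a, ha0, ha1, haB, haP⟩, b, hb1, hbB, hbP⟩ := hcon
  set g : ℂ → ℝ := fun z => (w.re - 1) * z.im - w.im * (z.re - 1) with hg
  have hgc : Continuous g := by fun_prop
  have hY : IsOpen {z : ℂ | 0 < z.im ∧ 0 < g z} :=
    (isOpen_lt continuous_const Complex.continuous_im).inter (isOpen_lt continuous_const hgc)
  have hY' : IsOpen {z : ℂ | z.im < 0 ∨ g z < 0} :=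
    (isOpen_lt Complex.continuous_im continuous_const).union (isOpen_lt hgc continuous_const)
  have hsub : Metric.ball (1 : ℂ) ε ∩ Pᶜ ⊆ {z : ℂ | 0 < z.im ∧ 0 < g z} ∪ {z : ℂ | z.im < 0 ∨ g z < 0} := by
    rintro z ⟨hzB, hzP⟩
    by_contra hn
    rw [mem_union, not_or] at hn
    obtain ⟨n1, n2⟩ := hn
    simp only [mem_ofPred_eq, not_or, not_and, not_lt] at n1 n2
    obtain ⟨n2, n3⟩ := n2
    apply hzP
    have hzre : 0 < z.re := by
      have h1 : ‖z - 1‖ < ε := by rwa [← mem_ball_iff_norm]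
      have h2 := Complex.abs_re_le_norm (z - 1)
      rw [Complex.sub_re, Complex.one_re] at h2
      have := abs_lt.1 (h2.trans_lt h1)
      linarith
    rcases n2.eq_or_lt with h' | h'
    · apply hseg
      have := (mem_rseg (z := z) zero_le_one).2 ⟨h'.symm, hzre.le, by
        simp only [hg, ← h'] at n3
        by_contra hc
        nlinarith⟩
      simpa using this
    · have hg0 : g z = 0 := le_antisymm (n1 h') n3
      set t := z.im / w.im with ht
      have ht0 : 0 < t := div_pos h' hwU
      have htw : t * w.im = z.im := by rw [ht]; field_simp
      have hz : z = 1 + t • (w - 1) := by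
        apply Complex.ext
        · simp only [hg] at hg0
          simp
          have : w.im * (z.re - 1) = w.im * (t * (w.re - 1)) := by
            have e : (w.re - 1) * z.im = w.im * (z.re - 1) := by linarith
            rw [← e, ← htw]; ring
          have := mul_left_cancel₀ hwU.ne' this
          linarith
        · simp [htw]
      rcases le_total t 1 with hle | hle
      · rw [hz]; exact (hcone w hwB t ht0 hle).2 hwP
      · refine (hcone z hzB t⁻¹ (by positivity) (inv_le_one_of_one_le₀ hle)).1 ?_
        have : 1 + t⁻¹ • (z - 1) = w := by
          rw [hz, add_sub_cancel_left, inv_smul_smul₀ ht0.ne']; ring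
        rwa [this]
  have ga : ∀ l : ℝ, g ((l : ℂ) * w) = (1 - l) * w.im := by
    intro l; simp [hg]; ring
  obtain ⟨z, -, hz1, hz2⟩ := hpre _ _ hY hY' hsub
    ⟨_, ⟨haB, haP⟩, by simp; positivity, by rw [ga]; exact mul_pos (by linarith) hwU⟩
    ⟨_, ⟨hbB, hbP⟩, Or.inr (by rw [ga]; nlinarith)⟩
  rcases hz2 with h2 | h2
  · exact absurd hz1.1 (not_lt.2 h2.le)
  · exact absurd hz1.2 (not_lt.2 h2.le)

lemma seg_bad_finite (a b : ℂ) :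
    {x : ℝ | ¬ ∀ᶠ z in 𝓝 (x : ℂ), z ∈ segment ℝ a b → z.im = 0}.Subsingleton := by
  intro x hx y hy
  have key : ∀ x : ℝ, (¬ ∀ᶠ z in 𝓝 (x : ℂ), z ∈ segment ℝ a b → z.im = 0) →
      (x : ℂ) ∈ segment ℝ a b := by
    intro x hx
    by_contra hn
    apply hx
    filter_upwards [(isClosed_seg a b).isOpen_compl.mem_nhds hn] with z hz hz'
    exact absurd hz' hz
  obtain ⟨t, -, -, ht⟩ := mem_seg_iff.1 (key x hx)
  obtain ⟨t', -, -, ht'⟩ := mem_seg_iff.1 (key y hy)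
  by_contra hne
  apply hx
  have i1 := congrArg Complex.im ht
  have i2 := congrArg Complex.im ht'
  simp at i1 i2
  have htt : t ≠ t' := by
    rintro rfl
    exact hne (by exact_mod_cast ht.trans ht'.symm)
  have hba : b.im - a.im = 0 := by
    have : (t - t') * (b.im - a.im) = 0 := by linarith
    rcases mul_eq_zero.1 this with h | h
    · exact absurd (sub_eq_zero.1 h) htt
    · exact h
  refine Eventually.of_forall fun z hz => ?_
  obtain ⟨r, -, -, rfl⟩ := mem_seg_iff.1 hz
  rw [hba] at i1
  simp [hba]
  linarith

lemma Poly.frontier_bad_finite (h : Poly P v) :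
    {x : ℝ | ¬ ∀ᶠ z in 𝓝 (x : ℂ), z ∈ frontier P → z.im = 0}.Finite := by
  refine (Set.finite_iUnion fun i : Fin n => (seg_bad_finite (v i) (v (i + 1))).finite).subset ?_
  intro x hx
  by_contra hn
  apply hx
  simp only [mem_iUnion, mem_ofPred_eq, not_exists, not_not] at hn
  filter_upwards [eventually_all.2 hn] with z hz hzF
  rw [h.2.2.2.2.2.1] at hzF
  obtain ⟨i, hi⟩ := mem_iUnion.1 hzF
  exact hz i hi

lemma Poly.good_of (h : Poly P v) {s : ℝ} {C : Set ℂ} (hCP : C ⊆ P)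
    (hsC : (s : ℂ) ∈ closure (C ∩ Up)) (hb : ∀ᶠ z in 𝓝 (s : ℂ), z ∈ frontier P → z.im = 0) :
    Good P s := by
  obtain ⟨r, hr, H⟩ := Metric.eventually_nhds_iff_ball.1 hb
  have hconv : Convex ℝ (Metric.ball (s : ℂ) r ∩ Up) :=
    (convex_ball _ _).inter (convex_halfSpace_im_gt 0)
  obtain ⟨w, hwB, hwC, hwU⟩ := mem_closure_iff.1 hsC _ Metric.isOpen_ball (Metric.mem_ball_self hr)
  have hall : Metric.ball (s : ℂ) r ∩ Up ⊆ P := fun z hz =>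
    preconn_frontier hconv.isPreconnected (fun u hu hF => hu.2.ne' (H u hu.1 hF))
      ⟨hwB, hwU⟩ hz (hCP hwC)
  filter_upwards [Metric.ball_mem_nhds _ hr] with z hz hz0
  have hcl : z ∈ closure Up := by
    have := Complex.closure_setOfPred_lt_im 0
    unfold Up
    rw [this]; exact hz0
  exact closure_minimal hall h.closed (Metric.isOpen_ball.inter_closure ⟨hz, hcl⟩)

lemma Poly.select (h : Poly P v) {C : Set ℂ} {x0 : ℂ}
    (hC : C = connectedComponentIn (P \ Vis P 0) x0)
    (h1V : (1 : ℂ) ∈ Vis P 0) (h1C : (1 : ℂ) ∈ closure (C ∩ Up)) :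
    ∃ s : ℝ, 0 < s ∧ (s : ℂ) ∈ Vis P 0 ∧ Good P s ∧ (s : ℂ) ∈ closure (C ∩ Up) := by
  have hCP : C ⊆ P \ Vis P 0 := by rw [hC]; exact connectedComponentIn_subset _ _
  have hclP : closure C ⊆ P := closure_minimal (fun z hz => (hCP hz).1) h.closed
  have habsorb : ∀ S : Set ℂ, IsPreconnected S → S ⊆ P \ Vis P 0 → (S ∩ C).Nonempty → S ⊆ C := by
    rintro S hS hSP ⟨z, hzS, hzC⟩
    rw [hC] at hzC
    rw [hC, connectedComponentIn_eq hzC]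
    exact hS.subset_connectedComponentIn hzS hSP
  obtain ⟨e0, he0, H0⟩ := h.local_conn h1V.1
  obtain ⟨e1, he1, H1⟩ := h.cone (1 : ℂ)
  set ε := min (min e0 e1) 1 with hε
  have hεpos : 0 < ε := lt_min (lt_min he0 he1) one_pos
  have hε1 : ε ≤ 1 := min_le_right _ _
  have hcone : ∀ z ∈ Metric.ball (1 : ℂ) ε, ∀ t : ℝ, 0 < t → t ≤ 1 →
      (1 + t • (z - 1) ∈ P ↔ z ∈ P) := fun z hz =>
    H1 z (Metric.ball_subset_ball ((min_le_left _ _).trans (min_le_right _ _)) hz)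
  have hpre := (H0 ε hεpos ((min_le_left _ _).trans (min_le_left _ _))).2
  -- choice of δ
  obtain ⟨δ, ⟨hδ0, hδε⟩, hδ⟩ : ∃ δ ∈ Ioo 0 ε,
      (∀ᶠ z in 𝓝 (((1 - δ : ℝ)) : ℂ), z ∈ frontier P → z.im = 0) ∧
      (∀ᶠ z in 𝓝 (((1 + δ : ℝ)) : ℂ), z ∈ frontier P → z.im = 0) := by
    have f := h.frontier_bad_finite
    have f1 := f.preimage (f := fun δ : ℝ => 1 - δ) (fun a _ b _ e => by simpa using e)
    have f2 := f.preimage (f := fun δ : ℝ => 1 + δ) (fun a _ b _ e => by simpa using e)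
    obtain ⟨δ, hδ, hn⟩ := ((Ioo_infinite hεpos).sdiff (f1.union f2)).nonempty
    refine ⟨δ, hδ, ?_⟩
    rw [mem_union, not_or] at hn
    simpa only [mem_preimage, mem_ofPred_eq, not_not] using hn
  have hreal : ∀ z : ℂ, z.im = 0 → 0 ≤ z.re → z.re ≤ 1 → z ∈ P := by
    intro z a b c
    apply h1V.2
    have := (mem_rseg (z := z) zero_le_one).2 ⟨a, b, c⟩
    simpa using this
  have scale : ∀ (μ l : ℝ), 0 ≤ l → l ≤ μ → ∀ w : ℂ, (l : ℂ) * w ∈ segment ℝ 0 ((μ : ℂ) * w) := by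
    intro μ l h0 hl w
    rcases (h0.trans hl).eq_or_lt with hm | hm
    · have : l = 0 := by linarith
      rw [this]; simpa using left_mem_segment ℝ (0 : ℂ) _
    refine mem_seg_iff.2 ⟨l / μ, by positivity, (div_le_one hm).2 hl, ?_⟩
    have : (μ : ℂ) ≠ 0 := by exact_mod_cast hm.ne'
    simp; field_simp
  have visdown : ∀ (μ l : ℝ), 0 ≤ l → l ≤ μ → ∀ w : ℂ, (μ : ℂ) * w ∈ Vis P 0 → (l : ℂ) * w ∈ Vis P 0 := by
    intro μ l h0 hl w hv
    refine ⟨hv.2 (scale μ l h0 hl w), fun u hu => hv.2 ?_⟩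
    exact (convex_segment (0 : ℂ) _).segment_subset (left_mem_segment _ _ _) (scale μ l h0 hl w) hu
  have ballmem : ∀ (μ l : ℝ) (w : ℂ), w ∈ Metric.ball (1 : ℂ) ε → (μ : ℂ) * w ∈ Metric.ball (1 : ℂ) ε →
      l ∈ segment ℝ μ 1 → (l : ℂ) * w ∈ Metric.ball (1 : ℂ) ε := by
    intro μ l w h1 h2 hl
    obtain ⟨a, b, ha, hb, hab, rfl⟩ := hl
    have := (convex_ball (1 : ℂ) ε) h2 h1 ha hb hab
    convert this using 1
    simp; ring
  have step : ∀ (μ : ℝ), 0 < μ → ∀ w ∈ C, w ∈ Metric.ball (1 : ℂ) ε →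
      (μ : ℂ) * w ∈ Metric.ball (1 : ℂ) ε →
      (∀ l : ℝ, l ∈ segment ℝ μ 1 → (l : ℂ) * w ∈ P) → (μ : ℂ) * w ∈ C := by
    intro μ hμ w hwC hwB hμB hl
    have him : IsPreconnected ((fun l : ℝ => (l : ℂ) * w) '' segment ℝ μ 1) :=
      (convex_segment μ 1).isPreconnected.image _ (by fun_prop)
    refine habsorb _ him ?_ ⟨w, ⟨1, right_mem_segment _ _ _, by simp⟩, hwC⟩
      ⟨μ, left_mem_segment _ _ _, rfl⟩
    rintro _ ⟨l, hlm, rfl⟩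
    refine ⟨hl l hlm, fun hv => (hCP hwC).2 ?_⟩
    have hwv : ((1 : ℝ) : ℂ) * w = w := by simp
    rcases le_total 1 l with hle | hle
    · have := visdown l 1 zero_le_one hle w hv
      rwa [hwv] at this
    · have hl0 : 0 < l := by
        rcases le_total μ 1 with hm | hm
        · rw [segment_eq_Icc hm] at hlm; exact hμ.trans_le hlm.1
        · rw [segment_symm, segment_eq_Icc hm] at hlm; exact one_pos.trans_le hlm.1
      refine ⟨(hCP hwC).1, fun u hu => ?_⟩
      obtain ⟨t, ht0, ht1, rfl⟩ := mem_seg_iff.1 hu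
      rw [sub_zero, zero_add, Complex.real_smul]
      rcases le_total t l with htl | htl
      · exact hv.2 (scale l t ht0 htl w)
      · apply hl
        exact (convex_segment μ 1).segment_subset hlm (right_mem_segment _ _ _)
          (by rw [segment_eq_Icc hle]; exact ⟨htl, ht1⟩)
  -- the two cases
  have main : ∀ (μ : ℝ), 0 < μ → ((μ : ℂ) ∈ Metric.ball (1 : ℂ) ε) →
      (∃ᶠ w in 𝓝 (1 : ℂ), w ∈ C ∩ Up ∧ ∀ l : ℝ, l ∈ segment ℝ μ 1 → (l : ℂ) * w ∈ Metric.ball (1 : ℂ) ε →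
        (l : ℂ) * w ∈ P) → (μ : ℂ) ∈ closure (C ∩ Up) := by
    intro μ hμ hμB hf
    have hc : ContinuousAt (fun w : ℂ => (μ : ℂ) * w) 1 := by fun_prop
    have hc' : Tendsto (fun w : ℂ => (μ : ℂ) * w) (𝓝 1) (𝓝 (μ : ℂ)) := by
      have := hc.tendsto; rwa [mul_one] at this
    rw [mem_closure_iff_frequently]
    refine hc'.frequently ?_
    have e1 : ∀ᶠ w in 𝓝 (1 : ℂ), w ∈ Metric.ball (1 : ℂ) ε := Metric.ball_mem_nhds _ hεpos
    have e2 := hc'.eventually (Metric.isOpen_ball.mem_nhds hμB)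
    refine (hf.and_eventually (e1.and e2)).mono ?_
    rintro w ⟨⟨⟨hwC, hwU⟩, hl⟩, hwB, hμwB⟩
    refine ⟨step μ hμ w hwC hwB hμwB fun l hlm => hl l hlm (ballmem μ l w hwB hμwB hlm), ?_⟩
    have : 0 < w.im := hwU
    show 0 < ((μ : ℂ) * w).im
    simp; positivity
  have hfreq : ∃ᶠ w in 𝓝 (1 : ℂ),
      (w ∈ C ∩ Up ∧ ∀ l : ℝ, l ∈ segment ℝ (1 - δ) 1 → (l : ℂ) * w ∈ Metric.ball (1 : ℂ) ε →
        (l : ℂ) * w ∈ P) ∨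
      (w ∈ C ∩ Up ∧ ∀ l : ℝ, l ∈ segment ℝ (1 + δ) 1 → (l : ℂ) * w ∈ Metric.ball (1 : ℂ) ε →
        (l : ℂ) * w ∈ P) := by
    have e1 : ∀ᶠ w in 𝓝 (1 : ℂ), w ∈ Metric.ball (1 : ℂ) ε := Metric.ball_mem_nhds _ hεpos
    refine ((mem_closure_iff_frequently.1 h1C).and_eventually e1).mono ?_
    rintro w ⟨⟨hwC, hwU⟩, hwB⟩
    have hwP : w ∈ P := (hCP hwC).1
    rcases dich h1V.2 hε1 hcone hpre hwP hwU hwB with hd | hd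
    · refine Or.inl ⟨⟨hwC, hwU⟩, fun l hl hlB => ?_⟩
      rw [segment_eq_Icc (by linarith)] at hl
      rcases hl.2.eq_or_lt with e | e
      · rw [e]; simpa using hwP
      · exact hd l (by linarith [hl.1]) e hlB
    · refine Or.inr ⟨⟨hwC, hwU⟩, fun l hl hlB => ?_⟩
      rw [segment_symm, segment_eq_Icc (by linarith)] at hl
      rcases hl.1.eq_or_lt with e | e
      · rw [← e]; simpa using hwP
      · exact hd l e hlB
  rcases frequently_or_distrib.1 hfreq with hf | hf
  · have hb : ((1 - δ : ℝ) : ℂ) ∈ Metric.ball (1 : ℂ) ε := by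
      have := mem_ball_real (x := 1) (τ := 1 - δ) (ε := ε) (by
        rw [show 1 - δ - 1 = -δ by ring, abs_neg, abs_of_pos hδ0]; exact hδε)
      simpa using this
    have hcl := main (1 - δ) (by linarith) hb hf
    refine ⟨1 - δ, by linarith, ?_, h.good_of (fun z hz => (hCP hz).1) hcl hδ.1, hcl⟩
    have := visdown 1 (1 - δ) (by linarith) (by linarith) 1 (by simpa using h1V)
    simpa using this
  · have hb : ((1 + δ : ℝ) : ℂ) ∈ Metric.ball (1 : ℂ) ε := by
      have := mem_ball_real (x := 1) (τ := 1 + δ) (ε := ε) (by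
        rw [show 1 + δ - 1 = δ by ring, abs_of_pos hδ0]; exact hδε)
      simpa using this
    have hcl := main (1 + δ) (by linarith) hb hf
    have hP : ((1 + δ : ℝ) : ℂ) ∈ P := hclP (closure_mono inter_subset_left hcl)
    refine ⟨1 + δ, by linarith, ⟨hP, fun z hz => ?_⟩, h.good_of (fun z hz => (hCP hz).1) hcl hδ.2, hcl⟩
    have hz' := (mem_rseg (z := z) (a := 0) (b := 1 + δ) (by linarith)).1 (by simpa using hz)
    rcases le_or_gt z.re 1 with hle | hgt
    · exact hreal z hz'.1 hz'.2.1 hle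
    · have := (hcone _ hb ((z.re - 1) / δ) (div_pos (by linarith) hδ0)
        ((div_le_one hδ0).2 (by linarith [hz'.2.2]))).2 hP
      convert this using 1
      have hδc : (δ : ℂ) ≠ 0 := by exact_mod_cast hδ0.ne'
      conv_lhs => rw [real_of_im hz'.1]
      simp
      field_simp
      ring

lemma Poly.updown (h : Poly P v) {C : Set ℂ} {x0 : ℂ}
    (hC : C = connectedComponentIn (P \ Vis P 0) x0)
    (h1V : (1 : ℂ) ∈ Vis P 0) (h1C : (1 : ℂ) ∈ closure C) :
    (1 : ℂ) ∈ closure (C ∩ Up) ∨ (1 : ℂ) ∈ closure (C ∩ {z | z.im < 0}) := by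
  have hCP : C ⊆ P \ Vis P 0 := by rw [hC]; exact connectedComponentIn_subset _ _
  obtain ⟨e1, he1, H1⟩ := h.cone (1 : ℂ)
  have e1' : ∀ᶠ w in 𝓝 (1 : ℂ), w ∈ Metric.ball (1 : ℂ) (min e1 1) :=
    Metric.ball_mem_nhds _ (lt_min he1 one_pos)
  simp only [mem_closure_iff_frequently] at h1C ⊢
  rw [← frequently_or_distrib]
  refine (h1C.and_eventually e1').mono ?_
  rintro w ⟨hwC, hwB⟩
  rcases lt_trichotomy w.im 0 with hi | hi | hi
  · exact Or.inr ⟨hwC, hi⟩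
  · exfalso
    apply (hCP hwC).2
    have hwP := (hCP hwC).1
    have hreal : ∀ z : ℂ, z.im = 0 → 0 ≤ z.re → z.re ≤ 1 → z ∈ P := by
      intro z a b c
      apply h1V.2
      have := (mem_rseg (z := z) zero_le_one).2 ⟨a, b, c⟩
      simpa using this
    have hre : 0 < w.re := by
      have h1 : ‖w - 1‖ < min e1 1 := by rwa [← mem_ball_iff_norm]
      have h2 := Complex.abs_re_le_norm (w - 1)
      rw [Complex.sub_re, Complex.one_re] at h2
      have := abs_lt.1 (h2.trans_lt (h1.trans_le (min_le_right _ _)))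
      linarith
    refine ⟨hwP, fun z hz => ?_⟩
    rw [real_of_im hi] at hz
    have hz' := (mem_rseg (z := z) (a := 0) (b := w.re) hre.le).1 (by simpa using hz)
    rcases le_or_gt z.re 1 with hle | hgt
    · exact hreal z hz'.1 hz'.2.1 hle
    · have hw1 : 0 < w.re - 1 := by linarith [hz'.2.2]
      have := (H1 w (Metric.ball_subset_ball (min_le_left _ _) hwB) ((z.re - 1) / (w.re - 1))
        (div_pos (by linarith) hw1) ((div_le_one hw1).2 (by linarith [hz'.2.2]))).2 hwP
      convert this using 1
      apply Complex.ext
      · rw [Complex.add_re, Complex.smul_re, Complex.sub_re, Complex.one_re, smul_eq_mul,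
          div_mul_cancel₀ _ hw1.ne']
        ring
      · rw [Complex.add_im, Complex.smul_im, Complex.sub_im, Complex.one_im, hi, hz'.1]
        simp
  · exact Or.inl ⟨hwC, hi⟩

end partE

end Pocket

namespace Pocket

section partF
open Set Filter Topology

section transport
variable {n : ℕ} [NeZero n]
variable {E F : Type*} [NormedAddCommGroup E] [NormedSpace ℝ E]
  [NormedAddCommGroup F] [NormedSpace ℝ F] {P C : Set E} {v : Fin n → E} {p x : E}

/-- affinity of a homeomorphism -/
def IsAff (φ : E ≃ₜ F) : Prop :=
  ∀ (x y : E) (t : ℝ), φ (x + t • (y - x)) = φ x + t • (φ y - φ x)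

lemma aff_segment {φ : E ≃ₜ F} (hφ : IsAff φ) (x y : E) :
    φ '' segment ℝ x y = segment ℝ (φ x) (φ y) := by
  ext z
  rw [mem_seg_iff]
  constructor
  · rintro ⟨u, hu, rfl⟩
    obtain ⟨t, h0, h1, rfl⟩ := mem_seg_iff.1 hu
    exact ⟨t, h0, h1, hφ _ _ _⟩
  · rintro ⟨t, h0, h1, rfl⟩
    exact ⟨_, mem_seg_iff.2 ⟨t, h0, h1, rfl⟩, hφ _ _ _⟩

lemma Poly.map (h : Poly P v) {φ : E ≃ₜ F} (hφ : IsAff φ) : Poly (φ '' P) (fun i => φ (v i)) := by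
  obtain ⟨h1, h2, h3, h4, h5, h6, h7, h8⟩ := h
  refine ⟨h1, φ.injective.comp h2, h3.image φ.continuous, ?_, ?_, ?_, ?_, ?_⟩
  · rw [← φ.image_interior]; exact h4.image _
  · rw [← φ.image_interior, ← φ.image_closure, ← h5]
  · rw [← φ.image_frontier, h6, image_iUnion]
    simp only [aff_segment hφ]
  · intro i
    rw [← aff_segment hφ, ← aff_segment hφ, ← image_inter φ.injective, h7, image_singleton]
  · intro i j a b c
    rw [← aff_segment hφ, ← aff_segment hφ]
    exact (disjoint_image_iff φ.injective).2 (h8 i j a b c)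

lemma vis_map {φ : E ≃ₜ F} (hφ : IsAff φ) : φ '' Vis P p = Vis (φ '' P) (φ p) := by
  ext z
  obtain ⟨u, rfl⟩ := φ.surjective z
  rw [φ.injective.mem_set_image]
  unfold Vis
  simp only [mem_ofPred_eq]
  rw [φ.injective.mem_set_image, ← aff_segment hφ, image_subset_image_iff φ.injective]

lemma comp_map {φ : E ≃ₜ F} (hφ : IsAff φ) (hx : x ∈ P \ Vis P p)
    (hC : C = connectedComponentIn (P \ Vis P p) x) :
    φ '' C = connectedComponentIn (φ '' P \ Vis (φ '' P) (φ p)) (φ x) := by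
  rw [hC, φ.image_connectedComponentIn hx, image_sdiff φ.injective, vis_map hφ]

lemma pullback {φ : E ≃ₜ F} (hφ : IsAff φ)
    (H : ∃ x ∈ φ '' P, ∃ y ∈ φ '' P, closure (φ '' C) ∩ Vis (φ '' P) (φ p) = segment ℝ x y) :
    ∃ x ∈ P, ∃ y ∈ P, closure C ∩ Vis P p = segment ℝ x y := by
  obtain ⟨_, ⟨a, ha, rfl⟩, _, ⟨b, hb, rfl⟩, H⟩ := H
  refine ⟨a, ha, b, hb, ?_⟩
  rw [← φ.image_closure, ← vis_map hφ, ← image_inter φ.injective, ← aff_segment hφ] at H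
  exact φ.injective.image_injective H

end transport

section plane
variable {n : ℕ} [NeZero n] {P C : Set ℂ} {v : Fin n → ℂ} {p x : ℂ}

lemma Poly.core (h : Poly P v) (h0 : (0 : ℂ) ∈ P) (hx : x ∈ P \ Vis P 0)
    (hC : C = connectedComponentIn (P \ Vis P 0) x)
    (h1V : (1 : ℂ) ∈ Vis P 0) (h1C : (1 : ℂ) ∈ closure C) :
    ∃ x ∈ P, ∃ y ∈ P, closure C ∩ Vis P 0 = segment ℝ x y := by
  rcases h.updown hC h1V h1C with hu | hd
  · obtain ⟨s, h1, h2, h3, h4⟩ := h.select hC h1V hu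
    exact h.gap_main h0 hC h1 h2 h3 h4
  · set φ : ℂ ≃ₜ ℂ := Complex.conjLIE.toHomeomorph with hφd
    have hφv : ∀ z, φ z = (starRingEnd ℂ) z := fun z => rfl
    have hφ : IsAff φ := by
      intro a b t
      simp [hφv]
    have e0 : φ 0 = 0 := by simp [hφv]
    have e1 : φ 1 = 1 := by simp [hφv]
    apply pullback hφ
    have h' := h.map hφ
    have hC' := comp_map hφ hx hC
    have hV' : φ 1 ∈ Vis (φ '' P) (φ 0) := by
      rw [← vis_map hφ]; exact mem_image_of_mem _ h1V
    have hcl : φ 1 ∈ closure (φ '' C ∩ Up) := by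
      have : φ '' (C ∩ {z | z.im < 0}) ⊆ φ '' C ∩ Up := by
        rintro _ ⟨z, ⟨hz1, hz2⟩, rfl⟩
        refine ⟨mem_image_of_mem _ hz1, ?_⟩
        show 0 < (φ z).im
        rw [hφv, Complex.conj_im]
        have : z.im < 0 := hz2
        linarith
      refine closure_mono this ?_
      rw [← φ.image_closure]
      exact mem_image_of_mem _ hd
    have h0' : φ 0 ∈ φ '' P := mem_image_of_mem _ h0
    rw [e0] at hC' hV' h0' ⊢
    rw [e1] at hV' hcl
    obtain ⟨s, h1, h2, h3, h4⟩ := h'.select hC' hV' hcl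
    exact h'.gap_main h0' hC' h1 h2 h3 h4

lemma Poly.core2 (h : Poly P v) (hp : p ∈ P) (hx : x ∈ P \ Vis P p)
    (hC : C = connectedComponentIn (P \ Vis P p) x) :
    ∃ x ∈ P, ∃ y ∈ P, closure C ∩ Vis P p = segment ℝ x y := by
  obtain ⟨q, hqC, hqV⟩ := h.comp_touch hp hx hC
  have hqp : q - p ≠ 0 := by
    intro e
    rw [sub_eq_zero.1 e] at hqC
    exact h.near_p hp hC hqC
  set φ : ℂ ≃ₜ ℂ := (Homeomorph.subRight p).trans (Homeomorph.mulRight₀ ((q - p)⁻¹) (inv_ne_zero hqp))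
    with hφd
  have hφv : ∀ z, φ z = (z - p) * (q - p)⁻¹ := fun z => rfl
  have hφ : IsAff φ := by
    intro a b t
    simp only [hφv, Complex.real_smul]
    ring
  have e0 : φ p = 0 := by simp [hφv]
  have e1 : φ q = 1 := by rw [hφv, mul_inv_cancel₀ hqp]
  apply pullback hφ
  have h' := h.map hφ
  have hC' := comp_map hφ hx hC
  have hV' : φ q ∈ Vis (φ '' P) (φ p) := by
    rw [← vis_map hφ]; exact mem_image_of_mem _ hqV
  have hcl : φ q ∈ closure (φ '' C) := by
    rw [← φ.image_closure]; exact mem_image_of_mem _ hqC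
  have hp' : φ p ∈ φ '' P := mem_image_of_mem _ hp
  have hx' : φ x ∈ φ '' P \ Vis (φ '' P) (φ p) := by
    rw [← vis_map hφ, ← image_sdiff φ.injective]; exact mem_image_of_mem _ hx
  rw [e0] at hC' hV' hp' hx' ⊢
  rw [e1] at hV' hcl
  exact h'.core hp' hx' hC' hV' hcl

end plane

lemma Poly.core3 {n : ℕ} [NeZero n] {P C : Set (EuclideanSpace ℝ (Fin 2))}
    {v : Fin n → EuclideanSpace ℝ (Fin 2)} {p x : EuclideanSpace ℝ (Fin 2)}
    (h : Poly P v) (hp : p ∈ P) (hx : x ∈ P \ Vis P p)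
    (hC : C = connectedComponentIn (P \ Vis P p) x) :
    ∃ x ∈ P, ∃ y ∈ P, closure C ∩ Vis P p = segment ℝ x y := by
  set ψ := Complex.orthonormalBasisOneI.repr.symm with hψ
  set φ : EuclideanSpace ℝ (Fin 2) ≃ₜ ℂ := ψ.toHomeomorph with hφd
  have hφv : ∀ z, φ z = ψ z := fun z => rfl
  have hφ : IsAff φ := by
    intro a b t
    simp only [hφv, map_add, map_sub, map_smul]
  have hx' : φ x ∈ φ '' P \ Vis (φ '' P) (φ p) := by
    rw [← vis_map hφ, ← image_sdiff φ.injective]; exact mem_image_of_mem _ hx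
  exact pullback hφ ((h.map hφ).core2 (mem_image_of_mem _ hp) hx' (comp_map hφ hx hC))

end partF

end Pocket


theorem pocket_single_constructed_edge {n : ℕ} [NeZero n]
    (P : Set (EuclideanSpace ℝ (Fin 2))) (v : Fin n → EuclideanSpace ℝ (Fin 2))
    (hP : IsSimplePolygonRegion P v)
    (p : EuclideanSpace ℝ (Fin 2)) (hp : p ∈ P)
    (C : Set (EuclideanSpace ℝ (Fin 2)))
    (hC : ∃ x ∈ P \ {q | q ∈ P ∧ segment ℝ p q ⊆ P},
      C = connectedComponentIn (P \ {q | q ∈ P ∧ segment ℝ p q ⊆ P}) x) :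
    ∃ x ∈ P, ∃ y ∈ P,
      closure C ∩ {q | q ∈ P ∧ segment ℝ p q ⊆ P} = segment ℝ x y := by
  obtain ⟨x, hx, hCx⟩ := hC
  have h : Pocket.Poly P v := hP
  exact h.core3 hp hx hCx
end

section
/- Let P ⊆ ℝ² be a simple polygon region with vertices v₁, …, vₙ, and let G ⊆ P be a finite set of points that guards the frontier of P, i.e., every point of the frontier of P is seen in P from some point of G. Let H be a connected component of P ∖ ⋃_{g ∈ G} Vis(g), where Vis(g) = {q ∈ P : [g,q] ⊆ P}. Then H is a convex set. -/
abbrev Pl := EuclideanSpace ℝ (Fin 2)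

lemma seg_union_of_line (p w : Pl) (i j k : ℝ) :
    segment ℝ (p + i • w) (p + k • w) ⊆
      segment ℝ (p + i • w) (p + j • w) ∪ segment ℝ (p + j • w) (p + k • w) := by
  have key : ∀ i j : ℝ, segment ℝ (p + i • w) (p + j • w) = (fun r : ℝ => p + r • w) '' Set.uIcc i j := by
    intro i j
    have h := image_segment ℝ (AffineMap.lineMap p (p + w) : ℝ →ᵃ[ℝ] Pl) i j
    rw [segment_eq_uIcc] at h
    simp only [AffineMap.lineMap_apply, vsub_eq_sub, add_sub_cancel_left, vadd_eq_add] at h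
    rw [add_comm p, add_comm p, ← h]
    ext z
    simp [AffineMap.lineMap_apply, add_comm]
  rw [key, key, key, ← Set.image_union]
  exact Set.image_mono Set.uIcc_subset_uIcc_union_uIcc

lemma plane_cases (A C : Pl) :
    (∃ w : Pl, ∃ i k : ℝ, A = i • w ∧ C = k • w) ∨
      ∀ g : Pl, ∃ α β : ℝ, g = α • A + β • C := by
  by_cases hd : A 0 * C 1 - A 1 * C 0 = 0
  · left
    by_cases hA : A = 0
    · exact ⟨C, 0, 1, by simp [hA], by simp⟩
    · by_cases h0 : A 0 = 0
      · have h1 : A 1 ≠ 0 := by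
          intro h1
          apply hA
          ext t
          fin_cases t <;> simp [h0, h1]
        refine ⟨A, 1, C 1 / A 1, by simp, ?_⟩
        ext t
        fin_cases t
        · simp [h0] at hd ⊢
          tauto
        · simp
          field_simp
      · refine ⟨A, 1, C 0 / A 0, by simp, ?_⟩
        ext t
        fin_cases t
        · simp
          field_simp
        · simp
          field_simp
          linarith
  · right
    intro g
    obtain ⟨D, hD⟩ : ∃ D, D = A 0 * C 1 - A 1 * C 0 := ⟨_, rfl⟩
    rw [← hD] at hd
    refine ⟨(g 0 * C 1 - g 1 * C 0) / D,
      (A 0 * g 1 - A 1 * g 0) / D, ?_⟩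
    ext t
    fin_cases t
    · simp
      field_simp
      rw [hD]
      ring
    · simp
      field_simp
      rw [hD]
      ring

/-- The key step: a hole cannot have a reflex corner. -/
lemma triangle_step (P U G : Set Pl) (hPc : IsClosed P) (hUo : IsOpen U)
    (hU : ∀ z, z ∈ U ↔ z ∈ P ∧ ∀ g ∈ G, ¬ segment ℝ g z ⊆ P)
    (a b c : Pl) (hab : segment ℝ a b ⊆ U) (hbc : segment ℝ b c ⊆ U) :
    segment ℝ a c ⊆ U := by
  obtain ⟨A, rfl⟩ : ∃ A, a = b + A := ⟨a - b, by simp⟩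
  obtain ⟨C, rfl⟩ : ∃ C, c = b + C := ⟨c - b, by simp⟩
  rcases plane_cases A C with ⟨w, i, k, rfl, rfl⟩ | hspan
  · have h := seg_union_of_line b w i 0 k
    simp only [zero_smul, add_zero] at h
    exact h.trans (Set.union_subset hab hbc)
  by_contra hcon
  obtain ⟨y, hy, hyU⟩ := Set.not_subset.1 hcon
  let f : ℝ × ℝ → Pl := fun q => b + q.1 • ((1 - q.2) • A + q.2 • C)
  have hf : Continuous f := by fun_prop
  let K : Set (ℝ × ℝ) := (Set.Icc 0 1 ×ˢ Set.Icc 0 1) ∩ f ⁻¹' Uᶜ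
  have hK : IsCompact K :=
    (isCompact_Icc.prod isCompact_Icc).inter_right (hUo.isClosed_compl.preimage hf)
  have hKne : K.Nonempty := by
    obtain ⟨r, s, hr, hs, hrs, rfl⟩ := hy
    refine ⟨(1, s), ⟨⟨by simp, by constructor <;> simp <;> linarith⟩, ?_⟩⟩
    have : f (1, s) = r • (b + A) + s • (b + C) := by
      obtain rfl : r = 1 - s := by linarith
      simp only [f]
      module
    simpa [this] using hyU
  obtain ⟨⟨t, l⟩, ⟨⟨⟨ht0, ht1⟩, hl0, hl1⟩, hbad⟩, hmin⟩ :=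
    hK.exists_isMinOn hKne continuous_fst.continuousOn
  simp only at ht0 ht1 hl0 hl1
  have hbU : b ∈ U := hbc (left_mem_segment ℝ _ _)
  have hA : ∀ r : ℝ, 0 ≤ r → r ≤ 1 → b + r • A ∈ U := fun r h0 h1 =>
    hab ⟨r, 1 - r, h0, by linarith, by ring, by module⟩
  have hC : ∀ r : ℝ, 0 ≤ r → r ≤ 1 → b + r • C ∈ U := fun r h0 h1 =>
    hbc ⟨1 - r, r, by linarith, h0, by ring, by module⟩
  have hx : f (t, l) ∉ U := hbad
  have htpos : 0 < t := by
    rcases ht0.lt_or_eq with h | h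
    · exact h
    · exact absurd (by simpa [f, ← h] using hbU) hx
  have hlpos : 0 < l := by
    rcases hl0.lt_or_eq with h | h
    · exact h
    · exact absurd (by simpa [f, ← h] using hA t ht0 ht1) hx
  have hllt : l < 1 := by
    rcases hl1.lt_or_eq with h | h
    · exact h
    · exact absurd (by simpa [f, h] using hC t ht0 ht1) hx
  have hin : ∀ u v : ℝ, 0 ≤ u → 0 ≤ v → u + v < t → b + u • A + v • C ∈ U := by
    intro u v hu hv huv
    rcases (add_nonneg hu hv).lt_or_eq with h | h
    · by_contra hn
      have hfe : f (u + v, v / (u + v)) = b + u • A + v • C := by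
        have e1 : (u + v) * (1 - v / (u + v)) = u := by field_simp; ring
        have e2 : (u + v) * (v / (u + v)) = v := by field_simp
        simp only [f, smul_add, smul_smul, e1, e2, add_assoc]
      have hm : (u + v, v / (u + v)) ∈ K := by
        refine ⟨⟨⟨h.le, by simp; linarith⟩, ⟨by positivity, ?_⟩⟩, ?_⟩
        · simp only
          rw [div_le_one h]
          linarith
        · rw [Set.mem_preimage, hfe]
          exact hn
      have := hmin hm
      simp at this
      linarith
    · obtain rfl : u = 0 := by linarith
      obtain rfl : v = 0 := by linarith
      simpa using hbU
  have hcl : ∀ u v : ℝ, 0 ≤ u → 0 ≤ v → u + v ≤ t → b + u • A + v • C ∈ P := by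
    intro u v hu hv huv
    have hcont : Continuous (fun r : ℝ => b + (r * u) • A + (r * v) • C) := by fun_prop
    have htend : Filter.Tendsto (fun r : ℝ => b + (r * u) • A + (r * v) • C)
        (nhdsWithin 1 (Set.Iio 1)) (nhds (b + u • A + v • C)) := by
      have := (hcont.tendsto 1).mono_left (nhdsWithin_le_nhds (s := Set.Iio 1))
      simpa using this
    refine hPc.mem_of_tendsto htend ?_
    have hev : ∀ᶠ r : ℝ in nhdsWithin 1 (Set.Iio 1), r ∈ Set.Ioo (0:ℝ) 1 :=
      Ioo_mem_nhdsLT (by norm_num)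
    filter_upwards [hev] with r hr
    refine ((hU _).1 (hin _ _ (mul_nonneg hr.1.le hu) (mul_nonneg hr.1.le hv) ?_)).1
    nlinarith [hr.1, hr.2]
  have hxe : f (t, l) = b + (t * (1 - l)) • A + (t * l) • C := by
    simp only [f]
    module
  set p := t * (1 - l) with hp
  set q := t * l with hq
  have hp0 : 0 < p := mul_pos htpos (by linarith)
  have hq0 : 0 < q := mul_pos htpos hlpos
  have hpq : p + q = t := by rw [hp, hq]; ring
  rw [hxe] at hx
  have hxP := hcl p q hp0.le hq0.le hpq.le
  obtain ⟨g, hgG, hgx⟩ : ∃ g ∈ G, segment ℝ g (b + p • A + q • C) ⊆ P := by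
    by_contra hno
    push Not at hno
    exact hx ((hU _).2 ⟨hxP, hno⟩)
  obtain ⟨α, β, hg⟩ := hspan (g - b)
  have hge : g = b + α • A + β • C := by
    rw [add_assoc, ← hg]; abel
  -- segments inside the closed triangle
  have htri : ∀ u v : ℝ, 0 ≤ u → 0 ≤ v → u + v ≤ t →
      segment ℝ (b + p • A + q • C) (b + u • A + v • C) ⊆ P := by
    rintro u v hu hv huv _ ⟨r, s, hr, hs, hrs, rfl⟩
    have h := hcl (r * p + s * u) (r * q + s * v) (by positivity) (by positivity)
      (by nlinarith)
    obtain rfl : r = 1 - s := by linarith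
    convert h using 1
    module
  -- a point of the triangle on the line through `g` and `x` lying in `U` is impossible
  have hno : ∀ e : ℝ, 0 ≤ p + e * (p - α) → 0 ≤ q + e * (q - β) →
      p + e * (p - α) + (q + e * (q - β)) ≤ t →
      b + (p + e * (p - α)) • A + (q + e * (q - β)) • C ∈ U → False := by
    intro e h1 h2 h3 h4
    refine ((hU _).1 h4).2 g hgG ?_
    have hs := seg_union_of_line g ((b + p • A + q • C) - g) 0 1 (1 + e)
    have e1 : g + (1:ℝ) • ((b + p • A + q • C) - g) = b + p • A + q • C := by simp
    have e2 : g + (1 + e) • ((b + p • A + q • C) - g) =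
        b + (p + e * (p - α)) • A + (q + e * (q - β)) • C := by
      rw [hge]; module
    rw [e1, e2, zero_smul, add_zero] at hs
    exact hs.trans (Set.union_subset hgx (htri _ _ h1 h2 h3))
  -- small perturbations keep both coordinates positive
  obtain ⟨d, hd0, hd⟩ : ∃ d : ℝ, 0 < d ∧ ∀ e : ℝ, |e| ≤ d →
      0 ≤ p + e * (p - α) ∧ 0 ≤ q + e * (q - β) := by
    have aux : ∀ p k : ℝ, 0 < p → ∃ d : ℝ, 0 < d ∧ ∀ e : ℝ, |e| ≤ d → 0 ≤ p + e * k := by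
      intro p k hp
      refine ⟨p / (|k| + 1), by positivity, fun e he => ?_⟩
      have h1 : |e| * (|k| + 1) ≤ p := by rwa [le_div_iff₀ (by positivity)] at he
      have h2 := neg_abs_le (e * k)
      rw [abs_mul] at h2
      nlinarith [abs_nonneg e]
    obtain ⟨d1, h1, h1'⟩ := aux p (p - α) hp0
    obtain ⟨d2, h2, h2'⟩ := aux q (q - β) hq0
    exact ⟨min d1 d2, lt_min h1 h2, fun e he =>
      ⟨h1' e (he.trans (min_le_left _ _)), h2' e (he.trans (min_le_right _ _))⟩⟩
  rcases lt_trichotomy (α + β) t with h | h | h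
  · obtain ⟨h1, h2⟩ := hd (-d) (by simp [abs_of_pos hd0])
    have h3 : p + -d * (p - α) + (q + -d * (q - β)) < t := by nlinarith
    exact hno _ h1 h2 h3.le (hin _ _ h1 h2 h3)
  · -- `g` lies on the line through the far side
    have haU : b + t • A ∈ U := hA t ht0 ht1
    refine ((hU _).1 haU).2 g hgG ?_
    have hs := seg_union_of_line (b + t • A) (C - A) β q 0
    have e1 : b + t • A + β • (C - A) = g := by
      rw [hge, ← h]; module
    have e2 : b + t • A + q • (C - A) = b + p • A + q • C := by
      rw [← hpq]; module
    rw [e1, e2, zero_smul, add_zero] at hs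
    refine hs.trans (Set.union_subset hgx ?_)
    simpa using htri t 0 ht0 le_rfl (by simp)
  · obtain ⟨h1, h2⟩ := hd d (by simp [abs_of_pos hd0])
    have h3 : p + d * (p - α) + (q + d * (q - β)) < t := by nlinarith
    exact hno _ h1 h2 h3.le (hin _ _ h1 h2 h3)

lemma vis_closed (P : Set Pl) (hP : IsClosed P) (g : Pl) :
    IsClosed {q : Pl | segment ℝ g q ⊆ P} := by
  have : {q : Pl | segment ℝ g q ⊆ P} =
      ⋂ t ∈ Set.Icc (0:ℝ) 1, (fun q : Pl => g + t • (q - g)) ⁻¹' P := by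
    ext q
    simp only [Set.mem_ofPred_eq, segment_eq_image', Set.image_subset_iff, Set.mem_iInter,
      Set.mem_preimage]
    rfl
  rw [this]
  exact isClosed_biInter fun t _ => hP.preimage (by fun_prop)

theorem hole_convex {n : ℕ} [NeZero n]
    (P : Set (EuclideanSpace ℝ (Fin 2))) (v : Fin n → EuclideanSpace ℝ (Fin 2))
    (hP : IsSimplePolygonRegion P v)
    (G : Set (EuclideanSpace ℝ (Fin 2)))
    (hG_fin : G.Finite) (hGP : G ⊆ P)
    (hG_guards : ∀ x ∈ frontier P, ∃ g ∈ G, segment ℝ g x ⊆ P)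
    (H : Set (EuclideanSpace ℝ (Fin 2)))
    (hH : ∃ x ∈ P \ ⋃ g ∈ G, {q | q ∈ P ∧ segment ℝ g q ⊆ P},
      H = connectedComponentIn (P \ ⋃ g ∈ G, {q | q ∈ P ∧ segment ℝ g q ⊆ P}) x) :
    Convex ℝ H := by
  obtain ⟨-, -, hcomp, -, -, -, -, -⟩ := hP
  have hPc := hcomp.isClosed
  obtain ⟨x₀, hx₀, rfl⟩ := hH
  set U := P \ ⋃ g ∈ G, {q | q ∈ P ∧ segment ℝ g q ⊆ P} with hUdef
  have hU : ∀ z, z ∈ U ↔ z ∈ P ∧ ∀ g ∈ G, ¬ segment ℝ g z ⊆ P := by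
    intro z
    simp only [hUdef, Set.mem_diff, Set.mem_iUnion, Set.mem_setOf_eq, not_exists, not_and]
    constructor
    · rintro ⟨h1, h2⟩
      exact ⟨h1, fun g hg => h2 g hg h1⟩
    · rintro ⟨h1, h2⟩
      exact ⟨h1, fun g hg _ => h2 g hg⟩
  have hUo : IsOpen U := by
    have : U = interior P ∩ (⋃ g ∈ G, {q : Pl | segment ℝ g q ⊆ P})ᶜ := by
      ext z
      rw [hU]
      simp only [Set.mem_inter_iff, Set.mem_compl_iff, Set.mem_iUnion, Set.mem_setOf_eq,
        not_exists]
      constructor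
      · rintro ⟨h1, h2⟩
        refine ⟨?_, h2⟩
        by_contra h3
        obtain ⟨g, hg, hgz⟩ := hG_guards z ⟨subset_closure h1, h3⟩
        exact h2 g hg hgz
      · rintro ⟨h1, h2⟩
        exact ⟨interior_subset h1, h2⟩
    rw [this]
    exact isOpen_interior.inter
      (hG_fin.isClosed_biUnion fun g _ => vis_closed P hPc g).isOpen_compl
  have step := triangle_step P U G hPc hUo hU
  have hHU : connectedComponentIn U x₀ ⊆ U := connectedComponentIn_subset _ _
  have hHpre : IsPreconnected (connectedComponentIn U x₀) := isPreconnected_connectedComponentIn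
  rw [convex_iff_segment_subset]
  intro x hx y hy
  have hball : ∀ z ∈ U, ∃ r > 0, ∀ z' ∈ Metric.ball z r,
      segment ℝ z z' ⊆ U ∧ segment ℝ z' z ⊆ U := by
    intro z hz
    obtain ⟨r, hr, hrU⟩ := Metric.isOpen_iff.1 hUo z hz
    refine ⟨r, hr, fun z' hz' => ?_⟩
    have := (convex_ball z r).segment_subset (Metric.mem_ball_self hr) hz'
    refine ⟨this.trans hrU, ?_⟩
    rw [segment_symm]
    exact this.trans hrU
  have hxyU : segment ℝ x y ⊆ U := by
    have hopen1 : IsOpen {z | z ∈ U ∧ segment ℝ x z ⊆ U} := by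
      rw [Metric.isOpen_iff]
      rintro z ⟨hz, hxz⟩
      obtain ⟨r, hr, hb⟩ := hball z hz
      exact ⟨r, hr, fun z' hz' =>
        ⟨(hb z' hz').1 (right_mem_segment ℝ _ _), step _ _ _ hxz (hb z' hz').1⟩⟩
    have hopen2 : IsOpen {z | z ∈ U ∧ ¬ segment ℝ x z ⊆ U} := by
      rw [Metric.isOpen_iff]
      rintro z ⟨hz, hxz⟩
      obtain ⟨r, hr, hb⟩ := hball z hz
      exact ⟨r, hr, fun z' hz' =>
        ⟨(hb z' hz').1 (right_mem_segment ℝ _ _), fun h => hxz (step _ _ _ h (hb z' hz').2)⟩⟩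
    by_contra hcon
    obtain ⟨z, -, hz1, hz2⟩ := hHpre _ _ hopen1 hopen2
      (fun z hz => by
        by_cases h : segment ℝ x z ⊆ U
        · exact Or.inl ⟨hHU hz, h⟩
        · exact Or.inr ⟨hHU hz, h⟩)
      ⟨x, hx, hHU hx, by simpa using hHU hx⟩ ⟨y, hy, hHU hy, hcon⟩
    exact hz2.2 hz1.2
  rw [connectedComponentIn_eq hx]
  exact (convex_segment x y).isPreconnected.subset_connectedComponentIn
    (left_mem_segment ℝ _ _) hxyU
end
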